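/- Let (Ω,Σ,P) be a probability space and let K be a convex set of random variables that is bounded in L^1(P). Let K̄ denote the closure of K in the topology of convergence in P-probability. The following are equivalent: (1) the relative L^0(P)-topology on K̄ is uniformly locally convex-solid on K̄; (2) there exists a probability measure Q equivalent to P such that K is Q-uniformly integrable. -/

import Mathlib

open MeasureTheory Filter Set ProbabilityTheory

noncomputable section

namespace Paper

variable {Ω : Type*} [MeasurableSpace Ω]

/-- The metric `d(X,Y) = E_P[min(|X - Y|, 1)]` metrizing convergence in `P`-probability. -/
def probDist (P : Measure Ω) (X Y : Ω → ℝ) : ℝ :=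
  ∫ ω, min |X ω - Y ω| 1 ∂P

/-- `Q` is a probability measure equivalent to `P` (mutually absolutely continuous). -/
def EquivProb (P Q : Measure Ω) : Prop :=
  IsProbabilityMeasure Q ∧ Q ≪ P ∧ P ≪ Q

/-- `K` is a set of `P`-integrable random variables bounded in `L¹(P)`. -/
def BddL1 (P : Measure Ω) (K : Set (Ω → ℝ)) : Prop :=
  (∀ X ∈ K, Integrable X P) ∧ ∃ C : ℝ, ∀ X ∈ K, (∫ ω, |X ω| ∂P) ≤ C

/-- `K` is `Q`-uniformly integrable: all members are `Q`-integrable and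
`sup_{X ∈ K} E_Q[|X| · 1_{|X| > c}] → 0` as `c → ∞`. -/
def UIset (Q : Measure Ω) (K : Set (Ω → ℝ)) : Prop :=
  (∀ X ∈ K, Integrable X Q) ∧
  ∀ ε : ℝ, 0 < ε → ∃ c : ℝ, ∀ X ∈ K, (∫ ω in {ω | c < |X ω|}, |X ω| ∂Q) < ε

/-- The sequence `Xs` is Cauchy in `P`-probability. -/
def CauchyInProb (P : Measure Ω) (Xs : ℕ → Ω → ℝ) : Prop :=
  ∀ ε : ℝ, 0 < ε →
    Tendsto (fun p : ℕ × ℕ => P {ω | ε ≤ |Xs p.1 ω - Xs p.2 ω|}) atTop (nhds 0)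

/-- The (sequential) closure of `K` in the topology of convergence in `P`-probability. -/
def probClosure (P : Measure Ω) (K : Set (Ω → ℝ)) : Set (Ω → ℝ) :=
  {X | ∃ Xs : ℕ → Ω → ℝ, (∀ n, Xs n ∈ K) ∧ TendstoInMeasure P Xs atTop X}

/-- A set `W` of random variables is solid: if `X ∈ W` and `|Y| ≤ |X|` a.s. then `Y ∈ W`. -/
def SolidSet (P : Measure Ω) (W : Set (Ω → ℝ)) : Prop :=
  ∀ X ∈ W, ∀ Y : Ω → ℝ, AEStronglyMeasurable Y P →
    (∀ᵐ ω ∂P, |Y ω| ≤ |X ω|) → Y ∈ W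

/-- The solid hull of a set `A` of random variables. -/
def solidHull (P : Measure Ω) (A : Set (Ω → ℝ)) : Set (Ω → ℝ) :=
  {Y | AEStronglyMeasurable Y P ∧ ∃ X ∈ A, ∀ᵐ ω ∂P, |Y ω| ≤ |X ω|}

/-- The relative `L⁰(P)`-topology on `K` is uniformly locally convex-solid on `S`:
for every `ε > 0` there is a convex solid set `W` of integrable random variables contained in the
`ε`-ball around `0` such that, for each `X ∈ S`, `(X + W) ∩ K` contains a `d`-ball of `K`
around `X`. -/
def UnifLCS (P : Measure Ω) (K S : Set (Ω → ℝ)) : Prop :=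
  ∀ ε : ℝ, 0 < ε → ∃ W : Set (Ω → ℝ),
    (∀ Z ∈ W, Integrable Z P) ∧ Convex ℝ W ∧ SolidSet P W ∧
    (∀ Z ∈ W, probDist P Z 0 < ε) ∧
    ∀ X ∈ S, ∃ δ : ℝ, 0 < δ ∧ ∀ Z ∈ K, probDist P Z X < δ → Z - X ∈ W

/-- The `L⁰(Q)`- and `L¹(Q)`-topologies agree on `K`: a sequence in `K` converges in
`P`-probability to a member of `K` iff it converges in `L¹(Q)`-norm. -/
def TopAgree (P Q : Measure Ω) (K : Set (Ω → ℝ)) : Prop :=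
  ∀ (Xs : ℕ → Ω → ℝ) (X : Ω → ℝ), (∀ n, Xs n ∈ K) → X ∈ K →
    (TendstoInMeasure P Xs atTop X ↔
      Tendsto (fun n => ∫⁻ ω, ENNReal.ofReal |Xs n ω - X ω| ∂Q) atTop (nhds 0))

/-- `W` is a forward convex combination of the sequence `Z`. -/
def IsFCC (Z : ℕ → Ω → ℝ) (W : ℕ → Ω → ℝ) : Prop :=
  ∀ k, W k ∈ convexHull ℝ (Z '' {n | k ≤ n})

/-- The relative `L⁰(P)`-topology on `K` is locally convex at `X` (forward convex combination
formulation): every FCC of a sequence in `K` converging to `X` in probability also converges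
to `X` in probability. -/
def LocConvexAt (P : Measure Ω) (K : Set (Ω → ℝ)) (X : Ω → ℝ) : Prop :=
  ∀ Xs : ℕ → Ω → ℝ, (∀ n, Xs n ∈ K) → TendstoInMeasure P Xs atTop X →
    ∀ W : ℕ → Ω → ℝ, IsFCC Xs W → TendstoInMeasure P W atTop X

/-- The set `L = {Σ_k a_k R_k : Σ_k |a_k| ≤ 1}` (with pointwise a.e. absolutely convergent
series, which also converge in `L¹(P)`). -/
def Lset (R : ℕ → Ω → ℝ) : Set (Ω → ℝ) :=
  {G | ∃ a : ℕ → ℝ, Summable (fun k => |a k|) ∧ (∑' k, |a k|) ≤ 1 ∧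
    G = fun ω => ∑' k, a k * R k ω}

/-- The standard Cauchy distribution on `ℝ`. -/
def cauchyLaw : Measure ℝ :=
  MeasureTheory.volume.withDensity (fun t => ENNReal.ofReal (1 / (Real.pi * (1 + t ^ 2))))

/-- Local convexity of the relative topology on `A ⊆ E` at a point `x ∈ A`, in a topological
vector space. -/
def LocConvexAtTVS {E : Type*} [AddCommGroup E] [Module ℝ E] [TopologicalSpace E]
    (A : Set E) (x : E) : Prop :=
  ∀ V ∈ nhds (0 : E), ∃ U ∈ nhds (0 : E), ∃ C : Set E,
    Convex ℝ C ∧ ((fun u => x + u) '' U) ∩ A ⊆ C ∧ C ⊆ ((fun v => x + v) '' V) ∩ A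

section Convergence

variable {P Q : Measure Ω}

lemma tendstoInMeasure_of_absolutelyContinuous [IsFiniteMeasure P] [IsFiniteMeasure Q]
    (hQP : Q ≪ P) {Xs : ℕ → Ω → ℝ} {X : Ω → ℝ} (hXs : ∀ n, AEStronglyMeasurable (Xs n) P)
    (h : TendstoInMeasure P Xs atTop X) : TendstoInMeasure Q Xs atTop X := by
  rw [exists_seq_tendstoInMeasure_atTop_iff hXs] at h
  rw [exists_seq_tendstoInMeasure_atTop_iff fun n => (hXs n).mono_ac hQP]
  intro ns hns
  obtain ⟨ns', h1, h2⟩ := h ns hns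
  exact ⟨ns', h1, hQP.ae_le h2⟩

lemma CauchyInProb.exists_seq_tendsto_ae [IsFiniteMeasure P] {Y : ℕ → Ω → ℝ}
    (hY : ∀ n, AEStronglyMeasurable (Y n) P) (h : CauchyInProb P Y) :
    ∃ ns : ℕ → ℕ, StrictMono ns ∧ ∃ Z : Ω → ℝ, StronglyMeasurable Z ∧
      ∀ᵐ ω ∂P, Tendsto (fun k => Y (ns k) ω) atTop (nhds (Z ω)) := by
  have key : ∀ n : ℕ, ∀ᶠ k in atTop, ∀ l ≥ k, ∀ m ≥ k,
      P {ω | (1 / 2 : ℝ) ^ n ≤ |Y l ω - Y m ω|} ≤ (1 / 2 : ENNReal) ^ n := by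
    intro n
    have h1 := (h ((1 / 2 : ℝ) ^ n) (by positivity)).eventually_le_const
      (u := (1 / 2 : ENNReal) ^ n) (by simp [pos_iff_ne_zero])
    obtain ⟨⟨a, b⟩, hab⟩ := eventually_atTop.1 h1
    filter_upwards [eventually_ge_atTop (max a b)] with k hk l hl m hm
    exact hab (l, m) ⟨(le_max_left a b).trans (hk.trans hl), (le_max_right a b).trans (hk.trans hm)⟩
  obtain ⟨ns, hns, hp⟩ := extraction_forall_of_eventually key
  have hsum : ∑' n : ℕ, P {ω | (1 / 2 : ℝ) ^ n ≤ |Y (ns n) ω - Y (ns (n + 1)) ω|} ≠ ⊤ := by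
    refine ne_top_of_le_ne_top ?_
      (ENNReal.tsum_le_tsum fun n => hp n _ le_rfl _ (hns.monotone n.le_succ))
    rw [ENNReal.tsum_geometric]
    simp
  have hae : ∀ᵐ ω ∂P, ∃ z, Tendsto (fun k => Y (ns k) ω) atTop (nhds z) := by
    filter_upwards [ae_eventually_notMem hsum] with ω hω
    obtain ⟨N, hN⟩ := eventually_atTop.1 hω
    apply cauchySeq_tendsto_of_complete
    rw [← cauchySeq_shift N]
    refine cauchySeq_of_le_geometric (1 / 2) 1 (by norm_num) fun n => ?_
    have h2 := hN (n + N) (Nat.le_add_left _ _)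
    simp only [not_le] at h2
    rw [Real.dist_eq, one_mul, show n + 1 + N = n + N + 1 by ring]
    exact h2.le.trans (pow_le_pow_of_le_one (by norm_num) (by norm_num) (Nat.le_add_right _ _))
  obtain ⟨Z, hZ, hlim⟩ := exists_stronglyMeasurable_limit_of_tendsto_ae (fun k => hY (ns k)) hae
  exact ⟨ns, hns, Z, hZ, hlim⟩

lemma integrable_min_abs_sub_one [IsFiniteMeasure P] {X Y : Ω → ℝ}
    (hX : AEStronglyMeasurable X P) (hY : AEStronglyMeasurable Y P) :
    Integrable (fun ω => min |X ω - Y ω| 1) P := by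
  refine (integrable_const (1 : ℝ)).mono' ?_ (.of_forall fun ω => ?_)
  · exact ((hX.sub hY).norm.inf aestronglyMeasurable_const)
  · rw [Real.norm_eq_abs, abs_of_nonneg (by positivity)]
    exact min_le_right _ _

lemma tendsto_probDist [IsProbabilityMeasure P] {Xs : ℕ → Ω → ℝ} {X : Ω → ℝ}
    (hXs : ∀ n, AEStronglyMeasurable (Xs n) P) (h : TendstoInMeasure P Xs atTop X) :
    Tendsto (fun n => probDist P (Xs n) X) atTop (nhds 0) := by
  have hX := h.aestronglyMeasurable hXs
  refine tendsto_of_subseq_tendsto fun ns hns => ?_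
  obtain ⟨ms, -, hms⟩ := (h.comp hns).exists_seq_tendsto_ae
  refine ⟨ms, ?_⟩
  have : (0 : ℝ) = ∫ ω, min |X ω - X ω| 1 ∂P := by simp
  rw [this]
  refine tendsto_integral_of_dominated_convergence (fun _ => 1)
    (fun n => (integrable_min_abs_sub_one (hXs _) hX).aestronglyMeasurable)
    (integrable_const _) (fun n => .of_forall fun ω => ?_) ?_
  · rw [Real.norm_eq_abs, abs_of_nonneg (by positivity)]
    exact min_le_right _ _
  · filter_upwards [hms] with ω hω
    exact ((hω.sub_const _).abs).min tendsto_const_nhds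

lemma tendstoInMeasure_of_tendsto_probDist [IsProbabilityMeasure P] {Xs : ℕ → Ω → ℝ} {X : Ω → ℝ}
    (hXs : ∀ n, AEStronglyMeasurable (Xs n) P) (hX : AEStronglyMeasurable X P)
    (h : Tendsto (fun n => probDist P (Xs n) X) atTop (nhds 0)) :
    TendstoInMeasure P Xs atTop X := by
  rw [tendstoInMeasure_iff_measureReal_dist]
  intro ε hε
  have hε' : 0 < min ε 1 := by positivity
  refine squeeze_zero (g := fun n => (min ε 1)⁻¹ * probDist P (Xs n) X)
    (fun n => measureReal_nonneg) (fun n => ?_) (by simpa using h.const_mul _)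
  have h1 := mul_meas_ge_le_integral_of_nonneg
    (.of_forall fun ω => by positivity) (integrable_min_abs_sub_one (hXs n) hX) (min ε 1)
  rw [← div_eq_inv_mul, le_div_iff₀' hε']
  refine le_trans ?_ h1
  refine mul_le_mul_of_nonneg_left (measureReal_mono fun ω hω => ?_) hε'.le
  simp only [mem_ofPred_eq] at hω ⊢
  exact min_le_min_right _ hω

end Convergence

section Weight

variable {P : Measure Ω}

lemma lintegral_le_of_tendsto_ae {f : ℕ → Ω → ENNReal} {g : Ω → ENNReal} {C : ENNReal}
    (hf : ∀ n, AEMeasurable (f n) P)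
    (hlim : ∀ᵐ ω ∂P, Tendsto (fun n => f n ω) atTop (nhds (g ω)))
    (hC : ∀ n, ∫⁻ ω, f n ω ∂P ≤ C) : ∫⁻ ω, g ω ∂P ≤ C := by
  calc ∫⁻ ω, g ω ∂P = ∫⁻ ω, liminf (fun n => f n ω) atTop ∂P :=
        lintegral_congr_ae (hlim.mono fun ω hω => hω.liminf_eq.symm)
    _ ≤ liminf (fun n => ∫⁻ ω, f n ω ∂P) atTop := lintegral_liminf_le' hf
    _ ≤ C := liminf_le_of_frequently_le' (Frequently.of_forall hC)

lemma exp_neg_convexCombo_le {t : ℝ} (ht0 : 0 ≤ t) (ht1 : 2 * t ≤ 1) (u z : ℝ) :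
    Real.exp (-((1 - t) * u + t * z)) ≤
      (Real.exp (-u / 2) ^ 2 + 2 * t * (Real.exp (-u / 2) - Real.exp (-u / 2) ^ 2)) *
        Real.exp (-(t * z)) := by
  have h := convexOn_exp.2 (mem_univ (u / 2)) (mem_univ 0)
    (by linarith : 0 ≤ 2 * t) (by linarith : 0 ≤ 1 - 2 * t) (by ring)
  simp only [smul_eq_mul, mul_zero, add_zero, Real.exp_zero, mul_one] at h
  have e1 : Real.exp (-u / 2) ^ 2 = Real.exp (-u) := by
    rw [← Real.exp_nat_mul]; congr 1; push_cast; ring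
  have e2 : Real.exp (-u / 2) = Real.exp (-u) * Real.exp (u / 2) := by
    rw [← Real.exp_add]; congr 1; ring
  have e3 : Real.exp (-((1 - t) * u + t * z)) =
      Real.exp (-u) * Real.exp (2 * t * (u / 2)) * Real.exp (-(t * z)) := by
    rw [← Real.exp_add, ← Real.exp_add]; congr 1; ring
  rw [e1, e2, e3]
  refine mul_le_mul_of_nonneg_right ?_ (Real.exp_pos _).le
  nlinarith [mul_le_mul_of_nonneg_left h (Real.exp_pos (-u)).le]

lemma one_sub_exp_neg_abs_le (z : ℝ) : 1 - Real.exp (-|z|) ≤ min |z| 1 := by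
  refine le_min ?_ ?_
  · linarith [Real.add_one_le_exp (-|z|)]
  · linarith [Real.exp_pos (-|z|)]

lemma tendsto_one_sub_exp_neg_mul_div (z : ℝ) :
    Tendsto (fun k : ℕ => (1 - Real.exp (-((1 / ((k : ℝ) + 2)) * z))) / (1 / ((k : ℝ) + 2)))
      atTop (nhds z) := by
  have hd : HasDerivAt (fun t : ℝ => 1 - Real.exp (-(t * z))) z 0 := by
    have := (((hasDerivAt_id (0 : ℝ)).mul_const z).neg.exp).const_sub 1
    simpa using this
  have ht : Tendsto (fun k : ℕ => 1 / ((k : ℝ) + 2)) atTop (nhdsWithin 0 {0}ᶜ) := by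
    refine tendsto_nhdsWithin_iff.2 ⟨?_, .of_forall fun k => ?_⟩
    · exact tendsto_const_nhds.div_atTop
        (tendsto_atTop_add_const_right _ _ tendsto_natCast_atTop_atTop)
    · have : (0 : ℝ) < 1 / ((k : ℝ) + 2) := by positivity
      simpa using this.ne'
  refine (hd.tendsto_slope_zero.comp ht).congr fun k => ?_
  simp [div_eq_inv_mul]

/-- A nonempty convex solid set that is small in probability is, up to a weight close to `1`,
small in `L¹`. -/
lemma exists_weight [IsProbabilityMeasure P] {W : Set (Ω → ℝ)} (hne : W.Nonempty)
    (hm : ∀ Z ∈ W, AEStronglyMeasurable Z P) (hc : Convex ℝ W) (hs : SolidSet P W) {ε : ℝ}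
    (hε : ∀ Z ∈ W, probDist P Z 0 < ε) :
    ∃ g : Ω → ℝ, Measurable g ∧ (∀ ω, 0 ≤ g ω) ∧ (∀ ω, g ω ≤ 1) ∧ 1 - ε ≤ ∫ ω, g ω ∂P ∧
      ∀ Z ∈ W, ∫⁻ ω, ENNReal.ofReal (g ω * |Z ω|) ∂P ≤ ENNReal.ofReal (2 * ε) := by
  set F : (Ω → ℝ) → ℝ := fun Z => ∫ ω, Real.exp (-|Z ω|) ∂P with hF
  have habs : ∀ Z ∈ W, (fun ω => |Z ω|) ∈ W := fun Z hZ =>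
    hs Z hZ _ (hm Z hZ).norm (.of_forall fun ω => by simp)
  have hmexp : ∀ Z ∈ W, AEStronglyMeasurable (fun ω => Real.exp (-|Z ω|)) P := fun Z hZ =>
    (by fun_prop : Continuous fun x : ℝ => Real.exp (-|x|)).comp_aestronglyMeasurable (hm Z hZ)
  have hibdd : ∀ f : Ω → ℝ, AEStronglyMeasurable f P → (∀ᵐ ω ∂P, 0 ≤ f ω) →
      (∀ᵐ ω ∂P, f ω ≤ 1) → Integrable f P := by
    intro f hf h0 h1
    refine (integrable_const (1 : ℝ)).mono' hf ?_
    filter_upwards [h0, h1] with ω h0 h1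
    rwa [Real.norm_eq_abs, abs_of_nonneg h0]
  have hiexp : ∀ Z ∈ W, Integrable (fun ω => Real.exp (-|Z ω|)) P := fun Z hZ =>
    hibdd _ (hmexp Z hZ) (.of_forall fun ω => (Real.exp_pos _).le)
      (.of_forall fun ω => by simp)
  have hFlow : ∀ Z ∈ W, 1 - ε ≤ F Z := by
    intro Z hZ
    have h1 := hε Z hZ
    have h2 : ∫ ω, (1 - Real.exp (-|Z ω|)) ∂P ≤ probDist P Z 0 := by
      refine integral_mono ((integrable_const _).sub (hiexp Z hZ))
        (integrable_min_abs_sub_one (hm Z hZ) aestronglyMeasurable_const) fun ω => ?_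
      simpa using one_sub_exp_neg_abs_le (Z ω)
    rw [integral_sub (integrable_const _) (hiexp Z hZ)] at h2
    simp only [integral_const, probReal_univ, smul_eq_mul, mul_one] at h2
    simp only [hF]
    linarith
  set I := sInf (F '' W) with hI
  have hbdd : BddBelow (F '' W) := ⟨0, by
    rintro _ ⟨Z, -, rfl⟩
    exact integral_nonneg fun ω => (Real.exp_pos _).le⟩
  have hIle : ∀ Z ∈ W, I ≤ F Z := fun Z hZ => csInf_le hbdd (mem_image_of_mem _ hZ)
  have hIlow : 1 - ε ≤ I := le_csInf (hne.image _) (by rintro _ ⟨Z, hZ, rfl⟩; exact hFlow Z hZ)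
  have hseq : ∀ n : ℕ, ∃ Z ∈ W, F Z < I + 1 / ((n : ℝ) + 1) := by
    intro n
    obtain ⟨_, ⟨Z, hZ, rfl⟩, h⟩ := exists_lt_of_csInf_lt (hne.image F)
      (show sInf (F '' W) < I + 1 / ((n : ℝ) + 1) by
        have : (0 : ℝ) < 1 / ((n : ℝ) + 1) := by positivity
        linarith)
    exact ⟨Z, hZ, h⟩
  choose Z hZW hZF using hseq
  set h : ℕ → Ω → ℝ := fun n ω => Real.exp (-|Z n ω| / 2) with hh
  have hhm : ∀ n, AEStronglyMeasurable (h n) P := fun n =>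
    (by fun_prop : Continuous fun x : ℝ => Real.exp (-|x| / 2)).comp_aestronglyMeasurable
      (hm _ (hZW n))
  have hh0 : ∀ n ω, 0 ≤ h n ω := fun n ω => (Real.exp_pos _).le
  have hh1 : ∀ n ω, h n ω ≤ 1 := fun n ω => by
    simp only [hh, Real.exp_le_one_iff]
    linarith [abs_nonneg (Z n ω)]
  have hhsq : ∀ n ω, h n ω ^ 2 = Real.exp (-|Z n ω|) := fun n ω => by
    simp only [hh]
    rw [← Real.exp_nat_mul]; congr 1; push_cast; ring
  have hsqint : ∀ n m, Integrable (fun ω => (h n ω - h m ω) ^ 2) P := fun n m =>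
    hibdd _ (((hhm n).sub (hhm m)).pow 2) (.of_forall fun ω => sq_nonneg _)
      (.of_forall fun ω => by
        have := hh0 n ω; have := hh0 m ω; have := hh1 n ω; have := hh1 m ω
        show (h n ω - h m ω) ^ 2 ≤ 1
        nlinarith)
  have hmid : ∀ n m, (fun ω => (1 / 2 : ℝ) * |Z n ω| + (1 / 2) * |Z m ω|) ∈ W := fun n m =>
    hc (habs _ (hZW n)) (habs _ (hZW m)) (by norm_num : (0 : ℝ) ≤ 1 / 2)
      (by norm_num : (0 : ℝ) ≤ 1 / 2) (by norm_num)
  have hsq : ∀ n m, ∫ ω, (h n ω - h m ω) ^ 2 ∂P ≤ 1 / ((n : ℝ) + 1) + 1 / ((m : ℝ) + 1) := by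
    intro n m
    have e : ∀ ω, (h n ω - h m ω) ^ 2 = Real.exp (-|Z n ω|) + Real.exp (-|Z m ω|)
        - 2 * Real.exp (-abs ((1 / 2 : ℝ) * |Z n ω| + (1 / 2) * |Z m ω|)) := by
      intro ω
      have hpos : 0 ≤ (1 / 2 : ℝ) * |Z n ω| + (1 / 2) * |Z m ω| := by positivity
      rw [abs_of_nonneg hpos, ← hhsq, ← hhsq]
      have : Real.exp (-((1 / 2 : ℝ) * |Z n ω| + (1 / 2) * |Z m ω|)) = h n ω * h m ω := by
        simp only [hh]
        rw [← Real.exp_add]; congr 1; ring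
      rw [this]; ring
    have hadd : Integrable (fun ω => Real.exp (-|Z n ω|) + Real.exp (-|Z m ω|)) P :=
      (hiexp _ (hZW n)).add (hiexp _ (hZW m))
    simp_rw [e]
    rw [integral_sub hadd ((hiexp _ (hmid n m)).const_mul 2),
      integral_add (hiexp _ (hZW n)) (hiexp _ (hZW m)), integral_const_mul]
    have h1 := hZF n
    have h2 := hZF m
    have h3 := hIle _ (hmid n m)
    simp only [hF] at h1 h2 h3
    linarith
  have hcauchy : CauchyInProb P h := by
    intro η hη
    have hb : ∀ p : ℕ × ℕ, P {ω | η ≤ |h p.1 ω - h p.2 ω|} ≤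
        ENNReal.ofReal ((1 / ((p.1 : ℝ) + 1) + 1 / ((p.2 : ℝ) + 1)) / η ^ 2) := by
      intro p
      have h1 := mul_meas_ge_le_integral_of_nonneg
        (.of_forall fun ω => sq_nonneg _) (hsqint p.1 p.2) (η ^ 2)
      have h2 : P.real {ω | η ≤ |h p.1 ω - h p.2 ω|} ≤
          P.real {ω | η ^ 2 ≤ (h p.1 ω - h p.2 ω) ^ 2} := by
        refine measureReal_mono fun ω hω => ?_
        simp only [mem_ofPred_eq] at hω ⊢
        rw [← sq_abs (h p.1 ω - _)]
        gcongr
      rw [← ofReal_measureReal]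
      refine ENNReal.ofReal_le_ofReal ?_
      rw [le_div_iff₀' (by positivity)]
      exact ((mul_le_mul_of_nonneg_left h2 (by positivity)).trans h1).trans (hsq _ _)
    refine tendsto_of_tendsto_of_tendsto_of_le_of_le tendsto_const_nhds ?_ (fun _ => zero_le) hb
    rw [← ENNReal.ofReal_zero]
    refine ENNReal.tendsto_ofReal ?_
    have h1 := tendsto_one_div_add_atTop_nhds_zero_nat (𝕜 := ℝ)
    have := ((h1.comp tendsto_fst).add (h1.comp tendsto_snd)).div_const (η ^ 2)
    rw [prod_atTop_atTop_eq] at this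
    simpa using this
  obtain ⟨ns, hns, h', hh'm, hlim⟩ := hcauchy.exists_seq_tendsto_ae hhm
  set H : Ω → ℝ := fun ω => max 0 (min (h' ω) 1) with hH
  have hHm : Measurable H := measurable_const.max (hh'm.measurable.min measurable_const)
  have hH0 : ∀ ω, 0 ≤ H ω := fun ω => le_max_left _ _
  have hH1 : ∀ ω, H ω ≤ 1 := fun ω => max_le zero_le_one (min_le_right _ _)
  have hlimH : ∀ᵐ ω ∂P, Tendsto (fun k => h (ns k) ω) atTop (nhds (H ω)) := by
    filter_upwards [hlim] with ω hω
    have h0 : 0 ≤ h' ω := ge_of_tendsto' hω fun k => hh0 _ _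
    have h1 : h' ω ≤ 1 := le_of_tendsto' hω fun k => hh1 _ _
    have : H ω = h' ω := by simp [hH, h0, h1]
    rwa [this]
  have hg1 : ∀ ω, H ω ^ 2 ≤ 1 := fun ω => pow_le_one₀ (hH0 ω) (hH1 ω)
  have hgi : Integrable (fun ω => H ω ^ 2) P := hibdd _ (hHm.pow_const 2).aestronglyMeasurable
    (.of_forall fun ω => sq_nonneg _) (.of_forall hg1)
  have hgI : ∫ ω, H ω ^ 2 ∂P = I := by
    have t1 : Tendsto (fun k => ∫ ω, h (ns k) ω ^ 2 ∂P) atTop (nhds (∫ ω, H ω ^ 2 ∂P)) := by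
      refine tendsto_integral_of_dominated_convergence (fun _ => 1) (fun n => (hhm _).pow 2)
        (integrable_const _) (fun n => .of_forall fun ω => ?_) ?_
      · rw [Real.norm_eq_abs, abs_of_nonneg (sq_nonneg _)]
        exact pow_le_one₀ (hh0 _ _) (hh1 _ _)
      · filter_upwards [hlimH] with ω hω using hω.pow 2
    have t2 : Tendsto (fun k => ∫ ω, h (ns k) ω ^ 2 ∂P) atTop (nhds I) := by
      simp_rw [hhsq]
      have t3 : Tendsto (fun k => I + 1 / ((ns k : ℝ) + 1)) atTop (nhds I) := by
        have := (tendsto_one_div_add_atTop_nhds_zero_nat (𝕜 := ℝ)).comp hns.tendsto_atTop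
        simpa using this.const_add I
      exact tendsto_of_tendsto_of_tendsto_of_le_of_le tendsto_const_nhds t3
        (fun k => hIle _ (hZW _)) (fun k => (hZF _).le)
    exact tendsto_nhds_unique t1 t2
  refine ⟨fun ω => H ω ^ 2, hHm.pow_const 2, fun ω => sq_nonneg _, hg1, hgI ▸ hIlow, ?_⟩
  intro Y hY
  have hYm : AEMeasurable Y P := (hm Y hY).aemeasurable
  have hfirst : ∀ t : ℝ, 0 < t → 2 * t ≤ 1 →
      ∫ ω, H ω ^ 2 * (1 - Real.exp (-(t * |Y ω|))) ∂P ≤ 2 * t * ε := by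
    intro t ht0 ht1
    set e : Ω → ℝ := fun ω => Real.exp (-(t * |Y ω|)) with he
    have hem : AEStronglyMeasurable e P :=
      (by fun_prop : Continuous fun x : ℝ => Real.exp (-(t * |x|))).comp_aestronglyMeasurable
        (hm Y hY)
    have he0 : ∀ ω, 0 ≤ e ω := fun ω => (Real.exp_pos _).le
    have he1 : ∀ ω, e ω ≤ 1 := fun ω => by
      simp only [he, Real.exp_le_one_iff]
      have := mul_nonneg ht0.le (abs_nonneg (Y ω))
      linarith
    have hpoly0 : ∀ x : ℝ, 0 ≤ x → x ≤ 1 → 0 ≤ x ^ 2 + 2 * t * (x - x ^ 2) := by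
      intro x h0 h1
      have : 0 ≤ x - x ^ 2 := by nlinarith
      positivity
    have hpoly1 : ∀ x : ℝ, 0 ≤ x → x ≤ 1 → x ^ 2 + 2 * t * (x - x ^ 2) ≤ 1 := by
      intro x h0 h1
      have : 0 ≤ x - x ^ 2 := by nlinarith
      nlinarith
    have hlb : I ≤ ∫ ω, (H ω ^ 2 + 2 * t * (H ω - H ω ^ 2)) * e ω ∂P := by
      have t1 : Tendsto
          (fun k => ∫ ω, (h (ns k) ω ^ 2 + 2 * t * (h (ns k) ω - h (ns k) ω ^ 2)) * e ω ∂P)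
          atTop (nhds (∫ ω, (H ω ^ 2 + 2 * t * (H ω - H ω ^ 2)) * e ω ∂P)) := by
        refine tendsto_integral_of_dominated_convergence (fun _ => 1)
          (fun n => (((hhm _).pow 2).add (((hhm _).sub ((hhm _).pow 2)).const_mul _)).mul hem)
          (integrable_const _) (fun n => .of_forall fun ω => ?_) ?_
        · have := hpoly0 _ (hh0 (ns n) ω) (hh1 (ns n) ω)
          have h2 := hpoly1 _ (hh0 (ns n) ω) (hh1 (ns n) ω)
          rw [Real.norm_eq_abs, abs_of_nonneg (mul_nonneg this (he0 ω))]
          exact mul_le_one₀ h2 (he0 ω) (he1 ω)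
        · filter_upwards [hlimH] with ω hω
          exact ((hω.pow 2).add ((hω.sub (hω.pow 2)).const_mul _)).mul_const _
      refine ge_of_tendsto' t1 fun k => ?_
      have hW : (fun ω => (1 - t) * |Z (ns k) ω| + t * |Y ω|) ∈ W :=
        hc (habs _ (hZW _)) (habs _ hY) (by linarith) ht0.le (by ring)
      refine (hIle _ hW).trans ?_
      refine integral_mono (hiexp _ hW) ?_ fun ω => ?_
      · refine hibdd _
          ((((hhm _).pow 2).add (((hhm _).sub ((hhm _).pow 2)).const_mul _)).mul hem)
          (.of_forall fun ω => mul_nonneg (hpoly0 _ (hh0 _ _) (hh1 _ _)) (he0 ω))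
          (.of_forall fun ω => mul_le_one₀ (hpoly1 _ (hh0 _ _) (hh1 _ _)) (he0 ω) (he1 ω))
      · have hnn : 0 ≤ (1 - t) * |Z (ns k) ω| + t * |Y ω| :=
          add_nonneg (mul_nonneg (by linarith) (abs_nonneg _)) (mul_nonneg ht0.le (abs_nonneg _))
        simp only [abs_of_nonneg hnn]
        exact exp_neg_convexCombo_le ht0.le ht1 _ _
    have hi1 : Integrable (fun ω => H ω ^ 2 * (1 - e ω)) P :=
      hibdd _ ((hHm.pow_const 2).aestronglyMeasurable.mul (aestronglyMeasurable_const.sub hem))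
        (.of_forall fun ω => mul_nonneg (sq_nonneg _) (by linarith [he1 ω]))
        (.of_forall fun ω => mul_le_one₀ (hg1 ω) (by linarith [he1 ω]) (by linarith [he0 ω]))
    have hi2 : Integrable (fun ω => (H ω ^ 2 + 2 * t * (H ω - H ω ^ 2)) * e ω) P :=
      hibdd _ ((by fun_prop : Measurable fun ω =>
          H ω ^ 2 + 2 * t * (H ω - H ω ^ 2)).aestronglyMeasurable.mul hem)
        (.of_forall fun ω => mul_nonneg (hpoly0 _ (hH0 _) (hH1 _)) (he0 ω))
        (.of_forall fun ω => mul_le_one₀ (hpoly1 _ (hH0 _) (hH1 _)) (he0 ω) (he1 ω))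
    have hi3 : Integrable (fun ω => 1 - H ω ^ 2) P := (integrable_const _).sub hgi
    have hsum : ∫ ω, H ω ^ 2 * (1 - e ω) ∂P + ∫ ω, (H ω ^ 2 + 2 * t * (H ω - H ω ^ 2)) * e ω ∂P ≤
        ∫ ω, (H ω ^ 2 + 2 * t * (1 - H ω ^ 2)) ∂P := by
      rw [← integral_add hi1 hi2]
      refine integral_mono (hi1.add hi2) (hgi.add (hi3.const_mul _))
        fun ω => ?_
      have a1 : 0 ≤ H ω - H ω ^ 2 := by nlinarith [hH0 ω, hH1 ω]
      have a2 : (H ω - H ω ^ 2) * e ω ≤ 1 - H ω ^ 2 :=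
        (mul_le_of_le_one_right a1 (he1 ω)).trans (by linarith [hH1 ω])
      have a3 := mul_le_mul_of_nonneg_left a2 (by linarith : 0 ≤ 2 * t)
      show H ω ^ 2 * (1 - e ω) + (H ω ^ 2 + 2 * t * (H ω - H ω ^ 2)) * e ω ≤
        H ω ^ 2 + 2 * t * (1 - H ω ^ 2)
      linarith
    rw [integral_add hgi (hi3.const_mul _), integral_const_mul,
      integral_sub (integrable_const _) hgi, hgI] at hsum
    simp only [integral_const, probReal_univ, smul_eq_mul, mul_one] at hsum
    have : 2 * t * (1 - I) ≤ 2 * t * ε := mul_le_mul_of_nonneg_left (by linarith) (by linarith)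
    linarith
  set s : ℕ → ℝ := fun k => 1 / ((k : ℝ) + 2) with hs
  have hs0 : ∀ k, 0 < s k := fun k => by simp only [hs]; positivity
  have hs1 : ∀ k, 2 * s k ≤ 1 := fun k => by
    simp only [hs]
    rw [mul_one_div, div_le_one (by positivity)]
    linarith [(Nat.cast_nonneg k : (0 : ℝ) ≤ k)]
  have hnn : ∀ k ω, 0 ≤ 1 - Real.exp (-(s k * |Y ω|)) := fun k ω => by
    rw [sub_nonneg, Real.exp_le_one_iff]
    linarith [mul_nonneg (hs0 k).le (abs_nonneg (Y ω))]
  refine lintegral_le_of_tendsto_ae (f := fun k ω =>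
      ENNReal.ofReal (H ω ^ 2 * ((1 - Real.exp (-(s k * |Y ω|))) / s k)))
    (fun k => by fun_prop) (.of_forall fun ω => ?_) fun k => ?_
  · exact ENNReal.tendsto_ofReal ((tendsto_one_sub_exp_neg_mul_div _).const_mul _)
  · rw [← ofReal_integral_eq_lintegral_ofReal]
    · refine ENNReal.ofReal_le_ofReal ?_
      simp_rw [← mul_div_assoc, integral_div]
      rw [div_le_iff₀ (hs0 k)]
      linarith [hfirst _ (hs0 k) (hs1 k)]
    · simp_rw [← mul_div_assoc]
      refine Integrable.div_const (hibdd _ ?_ ?_ ?_) _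
      · exact (by fun_prop : AEMeasurable (fun ω => H ω ^ 2 * (1 - Real.exp (-(s k * |Y ω|))))
          P).aestronglyMeasurable
      · exact .of_forall fun ω => mul_nonneg (sq_nonneg _) (hnn k ω)
      · exact .of_forall fun ω => mul_le_one₀ (hg1 ω) (hnn k ω) (by
          linarith [Real.exp_pos (-(s k * |Y ω|))])
    · exact .of_forall fun ω => mul_nonneg (sq_nonneg _) (div_nonneg (hnn k ω) (hs0 k).le)

end Weight

section EquivalentMeasure

variable {P : Measure Ω}

lemma subset_probClosure (K : Set (Ω → ℝ)) : K ⊆ probClosure P K := fun X hX =>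
  ⟨fun _ => X, fun _ => hX, tendstoInMeasure_of_ne_top fun ε hε _ => by
    simp [not_le.2 hε]⟩

lemma aestronglyMeasurable_of_mem_probClosure {K : Set (Ω → ℝ)}
    (hK : ∀ X ∈ K, AEStronglyMeasurable X P) {X : Ω → ℝ} (hX : X ∈ probClosure P K) :
    AEStronglyMeasurable X P := by
  obtain ⟨Xs, hXs, hlim⟩ := hX
  exact hlim.aestronglyMeasurable fun n => hK _ (hXs n)

lemma lintegral_abs_le_of_mem_probClosure {K : Set (Ω → ℝ)}
    (hK : ∀ X ∈ K, AEStronglyMeasurable X P) {C : ENNReal}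
    (hC : ∀ X ∈ K, ∫⁻ ω, ENNReal.ofReal |X ω| ∂P ≤ C) {X : Ω → ℝ} (hX : X ∈ probClosure P K) :
    ∫⁻ ω, ENNReal.ofReal |X ω| ∂P ≤ C := by
  obtain ⟨Xs, hXs, hlim⟩ := hX
  obtain ⟨ns, -, hns⟩ := hlim.exists_seq_tendsto_ae
  refine lintegral_le_of_tendsto_ae (f := fun n ω => ENNReal.ofReal |Xs (ns n) ω|)
    (fun n => (hK _ (hXs _)).aemeasurable.abs.ennreal_ofReal) ?_ (fun n => hC _ (hXs _))
  filter_upwards [hns] with ω hω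
  exact ENNReal.tendsto_ofReal hω.abs

lemma BddL1.exists_lintegral_le {K : Set (Ω → ℝ)} (hK : BddL1 P K) :
    ∃ C : ENNReal, C ≠ ⊤ ∧ ∀ X ∈ K, ∫⁻ ω, ENNReal.ofReal |X ω| ∂P ≤ C := by
  obtain ⟨hinteg, C, hC⟩ := hK
  refine ⟨ENNReal.ofReal C, ENNReal.ofReal_ne_top, fun X hX => ?_⟩
  rw [← ofReal_integral_eq_lintegral_ofReal (hinteg X hX).abs (.of_forall fun ω => abs_nonneg _)]
  exact ENNReal.ofReal_le_ofReal (hC X hX)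

lemma lintegral_abs_sub_le {μ : Measure Ω} {X Y : Ω → ℝ} (hX : AEStronglyMeasurable X μ) :
    ∫⁻ ω, ENNReal.ofReal |X ω - Y ω| ∂μ ≤
      ∫⁻ ω, ENNReal.ofReal |X ω| ∂μ + ∫⁻ ω, ENNReal.ofReal |Y ω| ∂μ := by
  rw [← lintegral_add_left' hX.aemeasurable.abs.ennreal_ofReal]
  refine lintegral_mono fun ω => ?_
  rw [← ENNReal.ofReal_add (abs_nonneg _) (abs_nonneg _)]
  exact ENNReal.ofReal_le_ofReal (abs_sub _ _)

lemma exists_common_weight [IsProbabilityMeasure P] {W : ℕ → Set (Ω → ℝ)}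
    (hne : ∀ m, (W m).Nonempty) (hm : ∀ m, ∀ Z ∈ W m, AEStronglyMeasurable Z P)
    (hc : ∀ m, Convex ℝ (W m)) (hs : ∀ m, SolidSet P (W m))
    (hε : ∀ m, ∀ Z ∈ W m, probDist P Z 0 < (1 / 2) ^ m) :
    ∃ f : Ω → ℝ, Measurable f ∧ (∀ ω, 0 ≤ f ω) ∧ (∀ ω, f ω ≤ 2) ∧ (∀ᵐ ω ∂P, 0 < f ω) ∧
      ∀ m, ∀ Z ∈ W m, ∫⁻ ω, ENNReal.ofReal (f ω * |Z ω|) ∂P ≤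
        ENNReal.ofReal (2 * (1 / 2) ^ m) +
          ENNReal.ofReal (1 / ((m : ℝ) + 1)) * ∫⁻ ω, ENNReal.ofReal |Z ω| ∂P := by
  choose g hgm hg0 hg1 hgint hgW using fun m =>
    exists_weight (hne m) (hm m) (hc m) (hs m) (hε m)
  have hbdd : ∀ ω, BddBelow (range fun m : ℕ => g m ω + 1 / ((m : ℝ) + 1)) := fun ω =>
    ⟨0, by rintro _ ⟨m, rfl⟩; have := hg0 m ω; positivity⟩
  set f : Ω → ℝ := fun ω => ⨅ m : ℕ, (g m ω + 1 / ((m : ℝ) + 1)) with hf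
  have hfle : ∀ m ω, f ω ≤ g m ω + 1 / ((m : ℝ) + 1) := fun m ω => ciInf_le (hbdd ω) m
  have hf0 : ∀ ω, 0 ≤ f ω := fun ω => le_ciInf fun m => by have := hg0 m ω; positivity
  refine ⟨f, .iInf fun m => (hgm m).add_const _, hf0, fun ω => ?_, ?_, fun m Z hZ => ?_⟩
  · have h1 := hfle 0 ω
    have h2 := hg1 0 ω
    norm_num at h1
    linarith
  · have hgi : ∀ m, Integrable (g m) P := fun m =>
      (integrable_const (1 : ℝ)).mono' (hgm m).aestronglyMeasurable (.of_forall fun ω => by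
        rw [Real.norm_eq_abs, abs_of_nonneg (hg0 m ω)]; exact hg1 m ω)
    have hle : ∀ m, ∫⁻ ω, ENNReal.ofReal (1 - g m ω) ∂P ≤ (1 / 2 : ENNReal) ^ m := by
      intro m
      have hi : Integrable (fun ω => 1 - g m ω) P := (integrable_const _).sub (hgi m)
      rw [← ofReal_integral_eq_lintegral_ofReal hi
        (.of_forall fun ω => sub_nonneg.2 (hg1 m ω)), integral_sub (integrable_const _) (hgi m)]
      have h2 : (1 / 2 : ENNReal) ^ m = ENNReal.ofReal ((1 / 2) ^ m) := by
        rw [ENNReal.ofReal_pow (by norm_num), ENNReal.ofReal_div_of_pos (by norm_num)]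
        simp
      rw [h2]
      refine ENNReal.ofReal_le_ofReal ?_
      have := hgint m
      simp only [integral_const, probReal_univ, smul_eq_mul, mul_one]
      linarith
    have hsum : ∫⁻ ω, ∑' m, ENNReal.ofReal (1 - g m ω) ∂P ≠ ⊤ := by
      rw [lintegral_tsum fun m => by have := hgm m; fun_prop]
      refine ne_top_of_le_ne_top ?_ (ENNReal.tsum_le_tsum hle)
      rw [ENNReal.tsum_geometric]
      simp
    have hmeas : AEMeasurable (fun ω => ∑' m, ENNReal.ofReal (1 - g m ω)) P :=
      (Measurable.tsum fun m => by have := hgm m; fun_prop).aemeasurable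
    filter_upwards [ae_lt_top' hmeas hsum] with ω hω
    have ht := ENNReal.tendsto_atTop_zero_of_tsum_ne_top hω.ne
    obtain ⟨N, hN⟩ := eventually_atTop.1
      (ht.eventually_lt_const (show (0 : ENNReal) < ENNReal.ofReal (1 / 2) by simp))
    have hpos : (0 : ℝ) < min (1 / 2) (1 / ((N : ℝ) + 1)) := by positivity
    refine hpos.trans_le (le_ciInf fun m => ?_)
    have hm1 : (0 : ℝ) < 1 / ((m : ℝ) + 1) := by positivity
    rcases le_total N m with h | h
    · have := (ENNReal.ofReal_lt_ofReal_iff (by norm_num)).1 (hN m h)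
      exact (min_le_left _ _).trans (by linarith)
    · have h3 : 1 / ((N : ℝ) + 1) ≤ 1 / ((m : ℝ) + 1) := by gcongr
      exact (min_le_right _ _).trans (by linarith [hg0 m ω])
  · calc ∫⁻ ω, ENNReal.ofReal (f ω * |Z ω|) ∂P
        ≤ ∫⁻ ω, (ENNReal.ofReal (g m ω * |Z ω|) +
            ENNReal.ofReal (1 / ((m : ℝ) + 1)) * ENNReal.ofReal |Z ω|) ∂P := by
          refine lintegral_mono fun ω => ?_
          rw [← ENNReal.ofReal_mul (by positivity),
            ← ENNReal.ofReal_add (mul_nonneg (hg0 m ω) (abs_nonneg _)) (by positivity), ← add_mul]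
          exact ENNReal.ofReal_le_ofReal
            (mul_le_mul_of_nonneg_right (hfle m ω) (abs_nonneg _))
      _ = ∫⁻ ω, ENNReal.ofReal (g m ω * |Z ω|) ∂P +
            ENNReal.ofReal (1 / ((m : ℝ) + 1)) * ∫⁻ ω, ENNReal.ofReal |Z ω| ∂P := by
          have hZm := (hm m Z hZ).aemeasurable
          have := hgm m
          rw [lintegral_add_left' (by fun_prop), lintegral_const_mul'' _ (by fun_prop)]
      _ ≤ _ := by gcongr; exact hgW m Z hZ

lemma exists_equivProb_of_weight [IsProbabilityMeasure P] {f : Ω → ℝ} (hfm : Measurable f)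
    (hf2 : ∀ ω, f ω ≤ 2) (hfpos : ∀ᵐ ω ∂P, 0 < f ω) :
    ∃ Q : Measure Ω, EquivProb P Q ∧ ∃ c : ENNReal, c ≠ ⊤ ∧ ∀ u : Ω → ENNReal, AEMeasurable u P →
      ∫⁻ ω, u ω ∂Q = c * ∫⁻ ω, ENNReal.ofReal (f ω) * u ω ∂P := by
  set d : Ω → ENNReal := fun ω => ENNReal.ofReal (f ω) with hd
  have hdm : Measurable d := hfm.ennreal_ofReal
  have hd0 : ∀ᵐ ω ∂P, d ω ≠ 0 := hfpos.mono fun ω hω => by simpa [hd] using hω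
  have htop : ∫⁻ ω, d ω ∂P ≠ ⊤ := by
    refine ne_top_of_le_ne_top (b := ∫⁻ _, ENNReal.ofReal 2 ∂P) (by simp) ?_
    exact lintegral_mono fun ω => ENNReal.ofReal_le_ofReal (hf2 ω)
  have hzero : ∫⁻ ω, d ω ∂P ≠ 0 := by
    rw [Ne, lintegral_eq_zero_iff hdm]
    intro h
    have hF : ∀ᵐ _ ∂P, False := by
      filter_upwards [h, hd0] with ω h1 h2 using h2 h1
    exact NeBot.ne inferInstance (eventually_false_iff_eq_bot.1 hF)
  have hc0 : (∫⁻ ω, d ω ∂P)⁻¹ ≠ 0 := ENNReal.inv_ne_zero.2 htop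
  refine ⟨(∫⁻ ω, d ω ∂P)⁻¹ • P.withDensity d, ⟨⟨?_⟩, ?_, ?_⟩, _, ENNReal.inv_ne_top.2 hzero,
    fun u hu => ?_⟩
  · simp [ENNReal.inv_mul_cancel hzero htop]
  · exact Measure.smul_absolutelyContinuous.trans (withDensity_absolutelyContinuous _ _)
  · exact (withDensity_absolutelyContinuous' hdm.aemeasurable hd0).trans
      (Measure.absolutelyContinuous_smul hc0)
  · rw [lintegral_smul_measure, lintegral_withDensity_eq_lintegral_mul₀ hdm.aemeasurable hu]
    rfl

/-- Under uniform local convex-solidity there is an equivalent probability for which convergence in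
probability of sequences in `K` upgrades to convergence in mean. -/
lemma exists_equivProb_tendsto_L1 [IsProbabilityMeasure P] {K : Set (Ω → ℝ)} (hne : K.Nonempty)
    (hK : BddL1 P K) (h : UnifLCS P (probClosure P K) (probClosure P K)) :
    ∃ Q : Measure Ω, EquivProb P Q ∧
      (∃ C : ENNReal, C ≠ ⊤ ∧ ∀ X ∈ K, ∫⁻ ω, ENNReal.ofReal |X ω| ∂Q ≤ C) ∧
      ∀ (Xs : ℕ → Ω → ℝ) (X : Ω → ℝ), (∀ n, Xs n ∈ K) → TendstoInMeasure P Xs atTop X →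
        Tendsto (fun n => ∫⁻ ω, ENNReal.ofReal |Xs n ω - X ω| ∂Q) atTop (nhds 0) := by
  obtain ⟨C, hCtop, hC⟩ := hK.exists_lintegral_le
  have hKm : ∀ X ∈ K, AEStronglyMeasurable X P := fun X hX => (hK.1 X hX).aestronglyMeasurable
  choose W hWi hWc hWs hWε hWn using fun m : ℕ => h ((1 / 2) ^ m) (by positivity)
  have hWne : ∀ m, (W m).Nonempty := by
    intro m
    obtain ⟨X, hX⟩ := hne
    obtain ⟨δ, hδ, hW⟩ := hWn m X (subset_probClosure K hX)
    exact ⟨_, hW X (subset_probClosure K hX) (by simpa [probDist] using hδ)⟩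
  have hWm : ∀ m, ∀ Z ∈ W m, AEStronglyMeasurable Z P := fun m Z hZ =>
    (hWi m Z hZ).aestronglyMeasurable
  obtain ⟨f, hfm, hf0, hf2, hfpos, hfW⟩ := exists_common_weight hWne hWm hWc hWs hWε
  obtain ⟨Q, hQ, c, hc, hQint⟩ := exists_equivProb_of_weight hfm hf2 hfpos
  refine ⟨Q, hQ, ⟨c * (2 * C), by finiteness, fun X hX => ?_⟩, fun Xs X hXs hlim => ?_⟩
  · have hXm := (hKm X hX).aemeasurable
    rw [hQint _ (by fun_prop)]
    gcongr
    refine le_trans ?_ (mul_le_mul_right (hC X hX) 2)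
    rw [← lintegral_const_mul'' _ (by fun_prop)]
    refine lintegral_mono fun ω => ?_
    gcongr
    simpa using ENNReal.ofReal_le_ofReal (hf2 ω)
  · have hXcl : X ∈ probClosure P K := ⟨Xs, hXs, hlim⟩
    have hXm := aestronglyMeasurable_of_mem_probClosure hKm hXcl
    have hdist := tendsto_probDist (fun n => hKm _ (hXs n)) hlim
    set b : ℕ → ENNReal := fun m =>
      c * (ENNReal.ofReal (2 * (1 / 2) ^ m) + ENNReal.ofReal (1 / ((m : ℝ) + 1)) * (C + C)) with hb
    have hb0 : Tendsto b atTop (nhds 0) := by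
      have h1 : Tendsto (fun m : ℕ => ENNReal.ofReal (2 * (1 / 2) ^ m)) atTop (nhds 0) := by
        rw [← ENNReal.ofReal_zero]
        refine ENNReal.tendsto_ofReal ?_
        simpa using (tendsto_pow_atTop_nhds_zero_of_lt_one (r := (1 / 2 : ℝ)) (by norm_num)
          (by norm_num)).const_mul 2
      have h2 : Tendsto (fun m : ℕ => ENNReal.ofReal (1 / ((m : ℝ) + 1))) atTop (nhds 0) := by
        rw [← ENNReal.ofReal_zero]
        exact ENNReal.tendsto_ofReal tendsto_one_div_add_atTop_nhds_zero_nat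
      have h3 := ENNReal.Tendsto.mul_const (b := C + C) h2 (Or.inr (by finiteness))
      have h4 := ENNReal.Tendsto.const_mul (a := c) (h1.add h3) (Or.inr hc)
      simpa only [zero_mul, add_zero, mul_zero] using h4
    rw [ENNReal.tendsto_nhds_zero]
    intro η hη
    obtain ⟨m, hm⟩ := (hb0.eventually_le_const hη).exists
    obtain ⟨δ, hδ, hW⟩ := hWn m X hXcl
    filter_upwards [hdist.eventually_lt_const hδ] with n hn
    have hZ := hW (Xs n) (subset_probClosure K (hXs n)) hn
    have hXsm := hKm _ (hXs n)
    have hdm : AEMeasurable (fun ω => ENNReal.ofReal |Xs n ω - X ω|) P :=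
      (hXsm.sub hXm).aemeasurable.abs.ennreal_ofReal
    refine le_trans ?_ hm
    rw [hQint _ hdm]
    simp only [hb]
    gcongr
    have h5 := hfW m _ hZ
    simp only [Pi.sub_apply] at h5
    simp_rw [← ENNReal.ofReal_mul (hf0 _)]
    refine h5.trans ?_
    gcongr
    refine (lintegral_abs_sub_le hXsm).trans ?_
    gcongr
    · exact hC _ (hXs n)
    · exact lintegral_abs_le_of_mem_probClosure hKm hC hXcl

end EquivalentMeasure

section ForwardConvexCombinations

variable {μ : Measure Ω}

lemma sqrt_one_add_sq_le (x : ℝ) : √(1 + x ^ 2) ≤ 1 + |x| := by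
  rw [Real.sqrt_le_left (by positivity)]
  nlinarith [abs_nonneg x, sq_abs x]

lemma sq_sub_le_sqrt_convexity_gap {M x y : ℝ} (hx : |x| ≤ M) (hy : |y| ≤ M) :
    (x - y) ^ 2 ≤ 4 * (1 + M) ^ 3 *
      (√(1 + x ^ 2) + √(1 + y ^ 2) - 2 * √(1 + (1 / 2 * x + 1 / 2 * y) ^ 2)) := by
  have hM : 0 ≤ M := (abs_nonneg x).trans hx
  have hz : |1 / 2 * x + 1 / 2 * y| ≤ M := by
    rw [abs_le] at *
    constructor <;> linarith [hx.1, hx.2, hy.1, hy.2]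
  have ha1 := (sqrt_one_add_sq_le x).trans (by linarith : 1 + |x| ≤ 1 + M)
  have hb1 := (sqrt_one_add_sq_le y).trans (by linarith : 1 + |y| ≤ 1 + M)
  have hm1 := (sqrt_one_add_sq_le (1 / 2 * x + 1 / 2 * y)).trans
    (by linarith : 1 + |1 / 2 * x + 1 / 2 * y| ≤ 1 + M)
  have ha2 := Real.sq_sqrt (by positivity : 0 ≤ 1 + x ^ 2)
  have hb2 := Real.sq_sqrt (by positivity : 0 ≤ 1 + y ^ 2)
  have hm2 := Real.sq_sqrt (by positivity : 0 ≤ 1 + (1 / 2 * x + 1 / 2 * y) ^ 2)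
  have ha0 : 0 < √(1 + x ^ 2) := Real.sqrt_pos.2 (by positivity)
  have hb0 : 0 < √(1 + y ^ 2) := Real.sqrt_pos.2 (by positivity)
  have hm0 : 0 < √(1 + (1 / 2 * x + 1 / 2 * y) ^ 2) := Real.sqrt_pos.2 (by positivity)
  have hxy : x * y ≤ M ^ 2 := by
    calc x * y ≤ |x * y| := le_abs_self _
      _ = |x| * |y| := abs_mul _ _
      _ ≤ M * M := mul_le_mul hx hy (abs_nonneg _) hM
      _ = M ^ 2 := by ring
  set a := √(1 + x ^ 2)
  set b := √(1 + y ^ 2)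
  set m := √(1 + (1 / 2 * x + 1 / 2 * y) ^ 2)
  have hab : (a * b) ^ 2 = (1 + x * y) ^ 2 + (x - y) ^ 2 := by
    rw [mul_pow, ha2, hb2]; ring
  have hab2 : (a * b) ^ 2 = 1 + x ^ 2 + y ^ 2 + (x * y) ^ 2 := by
    rw [mul_pow, ha2, hb2]; ring
  have hS0 : 0 < a * b + 1 + x * y := by
    have : |x * y| ≤ a * b := abs_le_of_sq_le_sq (by nlinarith [sq_nonneg x, sq_nonneg y])
      (by positivity)
    linarith [neg_abs_le (x * y)]
  have hS1 : a * b + 1 + x * y ≤ 2 * (1 + M) ^ 2 := by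
    have : a * b ≤ (1 + M) * (1 + M) := mul_le_mul ha1 hb1 hb0.le (by linarith)
    nlinarith
  have hT0 : 0 < a + b + 2 * m := by positivity
  have hT1 : a + b + 2 * m ≤ 4 * (1 + M) := by linarith
  have hid : (a + b - 2 * m) * ((a + b + 2 * m) * (a * b + 1 + x * y)) = 2 * (x - y) ^ 2 := by
    have h1 : (a + b - 2 * m) * (a + b + 2 * m) = 2 * (a * b - (1 + x * y)) := by
      have : (a + b - 2 * m) * (a + b + 2 * m) = a ^ 2 + b ^ 2 + 2 * (a * b) - 4 * m ^ 2 := by ring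
      rw [this, ha2, hb2, hm2]; ring
    have h2 : (a * b - (1 + x * y)) * (a * b + 1 + x * y) = (x - y) ^ 2 := by
      linear_combination hab
    rw [← mul_assoc, h1, mul_assoc, h2]
  have hprod : (a + b + 2 * m) * (a * b + 1 + x * y) ≤ 4 * (1 + M) * (2 * (1 + M) ^ 2) :=
    mul_le_mul hT1 hS1 hS0.le (by positivity)
  have hgap : 0 ≤ a + b - 2 * m := by
    by_contra! hneg
    have := mul_neg_of_neg_of_pos hneg (mul_pos hT0 hS0)
    nlinarith [sq_nonneg (x - y)]
  have := mul_le_mul_of_nonneg_left hprod hgap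
  rw [hid] at this
  linarith

/-- Every `L¹`-bounded sequence has forward convex combinations converging almost surely. -/
lemma exists_isFCC_tendsto_ae [IsProbabilityMeasure μ] {X : ℕ → Ω → ℝ}
    (hX : ∀ n, Integrable (X n) μ) {C : ℝ} (hC : ∀ n, ∫ ω, |X n ω| ∂μ ≤ C) :
    ∃ (Y : ℕ → Ω → ℝ) (Z : Ω → ℝ), IsFCC X Y ∧ StronglyMeasurable Z ∧
      ∀ᵐ ω ∂μ, Tendsto (fun k => Y k ω) atTop (nhds (Z ω)) := by
  set H : ℕ → Set (Ω → ℝ) := fun k => convexHull ℝ (X '' {n | k ≤ n}) with hH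
  have hHanti : ∀ {k l}, k ≤ l → H l ⊆ H k := fun hkl =>
    convexHull_mono (image_mono fun n hn => le_trans hkl hn)
  have hHint : ∀ k, ∀ Y ∈ H k, Integrable Y μ ∧ ∫ ω, |Y ω| ∂μ ≤ C := by
    intro k Y hY
    have hconv : Convex ℝ {Y : Ω → ℝ | Integrable Y μ ∧ ∫ ω, |Y ω| ∂μ ≤ C} := by
      rintro U ⟨hU, hUC⟩ V ⟨hV, hVC⟩ a b ha hb hab
      refine ⟨(hU.smul a).add (hV.smul b), ?_⟩
      calc ∫ ω, |(a • U + b • V) ω| ∂μ ≤ ∫ ω, (a * |U ω| + b * |V ω|) ∂μ := by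
            refine integral_mono ((hU.smul a).add (hV.smul b)).abs
              ((hU.abs.const_mul a).add (hV.abs.const_mul b)) fun ω => ?_
            refine (abs_add_le _ _).trans_eq ?_
            simp [abs_mul, abs_of_nonneg ha, abs_of_nonneg hb]
        _ = a * ∫ ω, |U ω| ∂μ + b * ∫ ω, |V ω| ∂μ := by
            rw [integral_add (hU.abs.const_mul a) (hV.abs.const_mul b), integral_const_mul,
              integral_const_mul]
        _ ≤ a * C + b * C := by gcongr
        _ = C := by rw [← add_mul, hab, one_mul]
    refine convexHull_min ?_ hconv hY
    rintro _ ⟨n, -, rfl⟩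
    exact ⟨hX n, hC n⟩
  set Φ : (Ω → ℝ) → ℝ := fun Y => ∫ ω, √(1 + Y ω ^ 2) ∂μ with hΦ
  have hiΦ : ∀ k, ∀ Y ∈ H k, Integrable (fun ω => √(1 + Y ω ^ 2)) μ := by
    intro k Y hY
    have hYi := (hHint k Y hY).1
    refine ((integrable_const (1 : ℝ)).add hYi.abs).mono' ?_ (.of_forall fun ω => ?_)
    · exact (by fun_prop : Continuous fun x : ℝ => √(1 + x ^ 2)).comp_aestronglyMeasurable
        hYi.aestronglyMeasurable
    · rw [Real.norm_eq_abs, abs_of_nonneg (Real.sqrt_nonneg _)]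
      exact sqrt_one_add_sq_le _
  have hΦle : ∀ k, ∀ Y ∈ H k, Φ Y ≤ 1 + C := by
    intro k Y hY
    obtain ⟨hYi, hYC⟩ := hHint k Y hY
    calc Φ Y ≤ ∫ ω, (1 + |Y ω|) ∂μ := integral_mono (hiΦ k Y hY)
          ((integrable_const (1 : ℝ)).add hYi.abs) fun ω => sqrt_one_add_sq_le _
      _ = 1 + ∫ ω, |Y ω| ∂μ := by
          rw [integral_add (integrable_const _) hYi.abs]; simp
      _ ≤ 1 + C := by gcongr
  have hHne : ∀ k, (H k).Nonempty := fun k =>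
    ⟨X k, subset_convexHull _ _ (mem_image_of_mem X (le_refl k))⟩
  have hbdd : ∀ k, BddBelow (Φ '' H k) := fun k => ⟨0, by
    rintro _ ⟨Y, -, rfl⟩
    exact integral_nonneg fun ω => Real.sqrt_nonneg _⟩
  set J : ℕ → ℝ := fun k => sInf (Φ '' H k) with hJ
  have hJle : ∀ k, ∀ Y ∈ H k, J k ≤ Φ Y := fun k Y hY => csInf_le (hbdd k) (mem_image_of_mem _ hY)
  have hJmono : Monotone J := fun k l hkl =>
    csInf_le_csInf (hbdd k) ((hHne l).image _) (image_mono (hHanti hkl))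
  have hJbdd : BddAbove (range J) := ⟨1 + C, by
    rintro _ ⟨k, rfl⟩
    obtain ⟨Y, hY⟩ := hHne k
    exact (hJle k Y hY).trans (hΦle k Y hY)⟩
  have hJlim := tendsto_atTop_ciSup hJmono hJbdd
  have hseq : ∀ k : ℕ, ∃ Y ∈ H k, Φ Y < J k + 1 / ((k : ℝ) + 1) := by
    intro k
    obtain ⟨_, ⟨Y, hY, rfl⟩, h⟩ := exists_lt_of_csInf_lt ((hHne k).image Φ)
      (show sInf (Φ '' H k) < J k + 1 / ((k : ℝ) + 1) by
        have : (0 : ℝ) < 1 / ((k : ℝ) + 1) := by positivity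
        linarith)
    exact ⟨Y, hY, h⟩
  choose Y hYH hYΦ using hseq
  set G : ℕ → ℕ → Ω → ℝ := fun n m ω => √(1 + Y n ω ^ 2) + √(1 + Y m ω ^ 2) -
    2 * √(1 + (1 / 2 * Y n ω + 1 / 2 * Y m ω) ^ 2) with hG
  have hmid : ∀ n m, (fun ω => 1 / 2 * Y n ω + 1 / 2 * Y m ω) ∈ H (min n m) := fun n m =>
    convex_convexHull ℝ _ (hHanti (min_le_left n m) (hYH n)) (hHanti (min_le_right n m) (hYH m))
      (by norm_num : (0 : ℝ) ≤ 1 / 2) (by norm_num : (0 : ℝ) ≤ 1 / 2) (by norm_num)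
  have hadd : ∀ n m, Integrable (fun ω => √(1 + Y n ω ^ 2) + √(1 + Y m ω ^ 2)) μ := fun n m =>
    (hiΦ _ _ (hYH n)).add (hiΦ _ _ (hYH m))
  have hGi : ∀ n m, Integrable (G n m) μ := fun n m =>
    (hadd n m).sub ((hiΦ _ _ (hmid n m)).const_mul 2)
  have hG0 : ∀ n m ω, 0 ≤ G n m ω := by
    intro n m ω
    have h1 := sq_sub_le_sqrt_convexity_gap (le_max_left |Y n ω| |Y m ω|)
      (le_max_right |Y n ω| |Y m ω|)
    exact nonneg_of_mul_nonneg_right ((sq_nonneg _).trans h1) (by positivity)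
  have hGle : ∀ n m, ∫ ω, G n m ω ∂μ ≤ |J n - J m| + (1 / ((n : ℝ) + 1) + 1 / ((m : ℝ) + 1)) := by
    intro n m
    simp only [hG]
    rw [integral_sub (hadd n m) ((hiΦ _ _ (hmid n m)).const_mul 2),
      integral_add (hiΦ _ _ (hYH n)) (hiΦ _ _ (hYH m)), integral_const_mul]
    have h1 := hYΦ n
    have h2 := hYΦ m
    have h3 := hJle _ _ (hmid n m)
    have h4 : J n + J m - 2 * J (min n m) = |J n - J m| := by
      rcases le_total n m with h | h
      · rw [min_eq_left h, abs_of_nonpos (sub_nonpos.2 (hJmono h))]; ring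
      · rw [min_eq_right h, abs_of_nonneg (sub_nonneg.2 (hJmono h))]; ring
    simp only [hΦ] at h1 h2 h3
    linarith
  have hDlim : Tendsto
      (fun p : ℕ × ℕ => |J p.1 - J p.2| + (1 / ((p.1 : ℝ) + 1) + 1 / ((p.2 : ℝ) + 1)))
      atTop (nhds 0) := by
    rw [← prod_atTop_atTop_eq]
    have h1 := tendsto_one_div_add_atTop_nhds_zero_nat (𝕜 := ℝ)
    have h2 := ((hJlim.comp tendsto_fst).sub (hJlim.comp tendsto_snd)).abs.add
      ((h1.comp tendsto_fst).add (h1.comp tendsto_snd))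
    simpa using h2
  have hcauchy : CauchyInProb μ Y := by
    intro η hη
    rw [← ENNReal.tendsto_toReal_iff (fun _ => measure_ne_top _ _) ENNReal.zero_ne_top]
    simp only [← measureReal_def, ENNReal.toReal_zero]
    rw [Metric.tendsto_nhds]
    intro δ hδ
    have hC0 : 0 ≤ C := (integral_nonneg fun ω => abs_nonneg _).trans (hC 0)
    set M : ℝ := 4 * C / δ + 1 with hM
    have hM0 : 0 < M := by positivity
    have htail : ∀ n, μ.real {ω | M ≤ |Y n ω|} ≤ δ / 4 := by
      intro n
      have h1 := mul_meas_ge_le_integral_of_nonneg (.of_forall fun ω => abs_nonneg (Y n ω))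
        (hHint n _ (hYH n)).1.abs M
      have h2 := h1.trans (hHint n _ (hYH n)).2
      rw [mul_comm, ← le_div_iff₀ hM0] at h2
      refine h2.trans ?_
      rw [div_le_iff₀ hM0, hM]
      field_simp
      linarith
    set κ : ℝ := η ^ 2 / (4 * (1 + M) ^ 3) with hκ
    have hκ0 : 0 < κ := by positivity
    have hsmall := hDlim.eventually_lt_const (show 0 < κ * (δ / 4) by positivity)
    filter_upwards [hsmall] with p hp
    have hGp : μ.real {ω | κ ≤ G p.1 p.2 ω} < δ / 4 := by
      have h1 := mul_meas_ge_le_integral_of_nonneg (.of_forall fun ω => hG0 p.1 p.2 ω)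
        (hGi p.1 p.2) κ
      exact lt_of_mul_lt_mul_left ((h1.trans (hGle _ _)).trans_lt hp) hκ0.le
    have hsub : {ω | η ≤ |Y p.1 ω - Y p.2 ω|} ⊆
        {ω | M ≤ |Y p.1 ω|} ∪ ({ω | M ≤ |Y p.2 ω|} ∪ {ω | κ ≤ G p.1 p.2 ω}) := by
      intro ω hω
      simp only [mem_union, mem_ofPred_eq] at hω ⊢
      by_contra! hcon
      have h1 := sq_sub_le_sqrt_convexity_gap hcon.1.le hcon.2.1.le
      have h2 : η ^ 2 ≤ (Y p.1 ω - Y p.2 ω) ^ 2 := by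
        rw [← sq_abs (Y p.1 ω - Y p.2 ω)]
        exact pow_le_pow_left₀ hη.le hω 2
      refine hcon.2.2.not_ge ?_
      rw [hκ, div_le_iff₀' (by positivity)]
      exact h2.trans h1
    rw [Real.dist_eq, sub_zero, abs_of_nonneg measureReal_nonneg]
    have h1 := (measureReal_mono hsub (measure_ne_top μ _)).trans
      ((measureReal_union_le _ _).trans (add_le_add_right (measureReal_union_le _ _) _))
    linarith [htail p.1, htail p.2]
  obtain ⟨ns, hns, Z, hZ, hlim⟩ := hcauchy.exists_seq_tendsto_ae
    fun n => (hHint n _ (hYH n)).1.aestronglyMeasurable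
  exact ⟨fun k => Y (ns k), Z, fun k => hHanti (hns.le_apply) (hYH (ns k)), hZ, hlim⟩

end ForwardConvexCombinations

section UniformIntegrability

variable {μ : Measure Ω}

/-- A test function almost aligned with the signs of a sequence on its large-value sets, provided
the later large-value sets carry little of the mass of the earlier members. -/
lemma exists_sign_test [IsFiniteMeasure μ] {X : ℕ → Ω → ℝ} (hXm : ∀ n, Measurable (X n))
    (hXi : ∀ n, Integrable (X n) μ) {c : ℝ} (hc : 0 ≤ c) {N : ℕ → ℝ} (hN : ∀ n, c ≤ N n)
    {D : ℕ → Set Ω} (hDm : ∀ n, MeasurableSet (D n)) (hD : Antitone D)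
    (hAD : ∀ n, {ω | N n < |X n ω|} ⊆ D n) :
    ∃ φ : Ω → ℝ, Measurable φ ∧ (∀ ω, |φ ω| ≤ 1) ∧ ∀ k n, k ≤ n →
      2 * ∫ ω in {ω | N n < |X n ω|}, |X n ω| ∂μ - ∫ ω in {ω | c < |X n ω|}, |X n ω| ∂μ -
        2 * ∫ ω in D (n + 1), |X n ω| ∂μ - c * μ.real (D k) ≤ ∫ ω in D k, φ ω * X n ω ∂μ := by
  classical
  have hAm : ∀ n (b : ℝ), MeasurableSet {ω | b < |X n ω|} := fun n b =>
    measurableSet_lt measurable_const (hXm n).abs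
  set B : ℕ → Set Ω := fun n => {ω | N n < |X n ω|} \ D (n + 1) with hB
  have hBdisj : ∀ m n ω, ω ∈ B m → ω ∈ B n → m = n := by
    intro m n ω hm hn
    by_contra hne
    rcases lt_or_gt_of_ne hne with h | h
    · exact hm.2 (hD h (hAD n hn.1))
    · exact hn.2 (hD h (hAD m hm.1))
  set E : Set Ω := ⋃ n, B n ∩ {ω | 0 < X n ω} with hE
  have hEm : MeasurableSet E := .iUnion fun n =>
    ((hAm n _).diff (hDm _)).inter (measurableSet_lt measurable_const (hXm n))
  have hφm : Measurable fun ω => if ω ∈ E then (1 : ℝ) else -1 :=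
    Measurable.ite hEm measurable_const measurable_const
  have hφ1 : ∀ ω, |if ω ∈ E then (1 : ℝ) else -1| ≤ 1 := fun ω => by split_ifs <;> simp
  refine ⟨fun ω => if ω ∈ E then 1 else -1, hφm, hφ1, fun k n hkn => ?_⟩
  have hsign : ∀ ω ∈ B n, (if ω ∈ E then (1 : ℝ) else -1) * X n ω = |X n ω| := by
    intro ω hω
    by_cases hpos : 0 < X n ω
    · have : ω ∈ E := mem_iUnion.2 ⟨n, hω, hpos⟩
      rw [if_pos this, one_mul, abs_of_pos hpos]
    · have : ω ∉ E := by
        intro hmem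
        obtain ⟨m, hm, hm'⟩ := mem_iUnion.1 hmem
        obtain rfl := hBdisj m n ω hm hω
        exact hpos hm'
      rw [if_neg this, neg_one_mul, abs_of_nonpos (not_lt.1 hpos)]
  have hi : ∀ S : Set Ω, MeasurableSet S → Integrable (S.indicator fun ω => |X n ω|) μ :=
    fun S hS => (hXi n).abs.indicator hS
  have hφi : Integrable (fun ω => (if ω ∈ E then (1 : ℝ) else -1) * X n ω) μ :=
    (hXi n).bdd_mul hφm.aestronglyMeasurable (.of_forall hφ1)
  have hpt : ∀ ω, 2 * ({ω | N n < |X n ω|}.indicator (fun ω => |X n ω|) ω) -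
      {ω | c < |X n ω|}.indicator (fun ω => |X n ω|) ω -
      2 * ((D (n + 1)).indicator (fun ω => |X n ω|) ω) - c * (D k).indicator 1 ω ≤
      (D k).indicator (fun ω => (if ω ∈ E then (1 : ℝ) else -1) * X n ω) ω := by
    intro ω
    have hlow : -|X n ω| ≤ (if ω ∈ E then (1 : ℝ) else -1) * X n ω := by
      split_ifs
      · rw [one_mul]; exact neg_abs_le _
      · rw [neg_one_mul]; exact neg_le_neg (le_abs_self _)
    have hx := abs_nonneg (X n ω)
    have hs := hsign ω
    by_cases h1 : ω ∈ D k
    · by_cases h2 : ω ∈ D (n + 1) <;> by_cases h3 : N n < |X n ω| <;>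
        by_cases h4 : c < |X n ω| <;>
        simp only [indicator, mem_ofPred_eq, Pi.one_apply, if_pos h1, h2, h3, h4, if_true,
          if_false] <;>
        first
        | linarith [hN n]
        | (have := hs ⟨h3, h2⟩; linarith)
    · have h2 : ω ∉ D (n + 1) := fun h => h1 (hD (by omega) h)
      have h3 : ¬ N n < |X n ω| := fun h => h1 (hD hkn (hAD n h))
      by_cases h4 : c < |X n ω| <;>
        simp only [indicator, mem_ofPred_eq, Pi.one_apply, h1, h2, h3, h4, if_true, if_false] <;>
        linarith
  rw [← integral_indicator (hAm n _), ← integral_indicator (hAm n _),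
    ← integral_indicator (hDm _), ← integral_indicator (hDm _), ← integral_indicator_one (hDm k),
    ← integral_const_mul, ← integral_const_mul, ← integral_const_mul]
  have i1 := (hi _ (hAm n (N n))).const_mul 2
  have i2 := hi _ (hAm n c)
  have i3 := (hi _ (hDm (n + 1))).const_mul 2
  have i4 : Integrable (fun ω => c * (D k).indicator (1 : Ω → ℝ) ω) μ :=
    ((integrable_const (1 : ℝ)).indicator (hDm k)).const_mul c
  have j1 : Integrable (fun ω => 2 * {ω | N n < |X n ω|}.indicator (fun ω => |X n ω|) ω -
      {ω | c < |X n ω|}.indicator (fun ω => |X n ω|) ω) μ := i1.sub i2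
  have j2 : Integrable (fun ω => 2 * {ω | N n < |X n ω|}.indicator (fun ω => |X n ω|) ω -
      {ω | c < |X n ω|}.indicator (fun ω => |X n ω|) ω -
      2 * (D (n + 1)).indicator (fun ω => |X n ω|) ω) μ := j1.sub i3
  rw [← integral_sub i1 i2, ← integral_sub j1 i3, ← integral_sub j2 i4]
  exact integral_mono (j2.sub i4) (hφi.indicator (hDm k)) hpt

lemma nonpos_of_le_setIntegral_mul [IsProbabilityMeasure μ] {K : Set (Ω → ℝ)} (hK : Convex ℝ K)
    (hKi : ∀ X ∈ K, Integrable X μ) {C : ℝ} (hC : ∀ X ∈ K, ∫ ω, |X ω| ∂μ ≤ C)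
    (h : ∀ (Xs : ℕ → Ω → ℝ) (X : Ω → ℝ), (∀ n, Xs n ∈ K) → TendstoInMeasure μ Xs atTop X →
      Tendsto (fun n => ∫⁻ ω, ENNReal.ofReal |Xs n ω - X ω| ∂μ) atTop (nhds 0))
    {X : ℕ → Ω → ℝ} (hX : ∀ n, X n ∈ K) {φ : Ω → ℝ} (hφm : Measurable φ) (hφ : ∀ ω, |φ ω| ≤ 1)
    {D : ℕ → Set Ω} (hD : Tendsto (fun k => μ (D k)) atTop (nhds 0))
    {a c : ℝ}
    (hle : ∀ k n, k ≤ n → a - c * μ.real (D k) ≤ ∫ ω in D k, φ ω * X n ω ∂μ) : a ≤ 0 := by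
  obtain ⟨Y, Z, hY, hZ, hlim⟩ := exists_isFCC_tendsto_ae (fun n => hKi _ (hX n))
    fun n => hC _ (hX n)
  have hmul : ∀ U, Integrable U μ → Integrable (fun ω => φ ω * U ω) μ := fun U hU =>
    hU.bdd_mul hφm.aestronglyMeasurable (.of_forall hφ)
  have hYK : ∀ k, Y k ∈ K := fun k => convexHull_min (by rintro _ ⟨n, -, rfl⟩; exact hX n) hK (hY k)
  have hYle : ∀ k, a - c * μ.real (D k) ≤ ∫ ω in D k, φ ω * Y k ω ∂μ := by
    intro k
    have hconv : Convex ℝ {U : Ω → ℝ | Integrable U μ ∧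
        a - c * μ.real (D k) ≤ ∫ ω in D k, φ ω * U ω ∂μ} := by
      rintro U ⟨hU, hU'⟩ V ⟨hV, hV'⟩ s t hs ht hst
      refine ⟨(hU.smul s).add (hV.smul t), ?_⟩
      have h1 : ∫ ω in D k, φ ω * (s • U + t • V) ω ∂μ =
          s * ∫ ω in D k, φ ω * U ω ∂μ + t * ∫ ω in D k, φ ω * V ω ∂μ := by
        rw [← integral_const_mul, ← integral_const_mul,
          ← integral_add ((hmul U hU).integrableOn.const_mul s)
            ((hmul V hV).integrableOn.const_mul t)]
        refine integral_congr_ae (.of_forall fun ω => ?_)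
        simp only [Pi.add_apply, Pi.smul_apply, smul_eq_mul]
        ring
      rw [h1]
      calc a - c * μ.real (D k) = s * (a - c * μ.real (D k)) + t * (a - c * μ.real (D k)) := by
            rw [← add_mul, hst, one_mul]
        _ ≤ _ := by gcongr
    refine (convexHull_min ?_ hconv (hY k)).2
    rintro _ ⟨n, hn, rfl⟩
    exact ⟨hKi _ (hX n), hle k n hn⟩
  have hYm := fun k => (hKi _ (hYK k)).aestronglyMeasurable
  have hL1 := h Y Z hYK (tendstoInMeasure_of_tendsto_ae hYm hlim)
  have hZi : Integrable Z μ := by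
    obtain ⟨k, hk⟩ := (hL1.eventually_lt_const ENNReal.zero_lt_top).exists
    have : Integrable (fun ω => Y k ω - Z ω) μ := by
      refine ⟨(hYm k).sub hZ.aestronglyMeasurable, ?_⟩
      simpa only [HasFiniteIntegral, Real.enorm_eq_ofReal_abs] using hk
    exact ((hKi _ (hYK k)).sub this).congr (.of_forall fun ω => sub_sub_cancel _ _)
  have hdi : ∀ k, Integrable (fun ω => |Y k ω - Z ω|) μ := fun k => ((hKi _ (hYK k)).sub hZi).abs
  have hL1' : Tendsto (fun k => ∫ ω, |Y k ω - Z ω| ∂μ) atTop (nhds 0) := by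
    rw [← ENNReal.toReal_zero]
    refine ((ENNReal.tendsto_toReal ENNReal.zero_ne_top).comp hL1).congr fun k => ?_
    rw [integral_eq_lintegral_of_nonneg_ae (.of_forall fun ω => abs_nonneg _)
      (hdi k).aestronglyMeasurable]
    rfl
  have hZD : Tendsto (fun k => ∫ ω in D k, |Z ω| ∂μ) atTop (nhds 0) :=
    hZi.abs.tendsto_setIntegral_nhds_zero hD
  have hDr : Tendsto (fun k => c * μ.real (D k)) atTop (nhds 0) := by
    simpa [measureReal_def] using
      ((ENNReal.tendsto_toReal ENNReal.zero_ne_top).comp hD).const_mul c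
  have hsum := (hL1'.add hZD).add hDr
  rw [add_zero, add_zero] at hsum
  refine ge_of_tendsto' hsum fun k => ?_
  have h1 : ∫ ω in D k, φ ω * Y k ω ∂μ ≤ ∫ ω in D k, (|Y k ω - Z ω| + |Z ω|) ∂μ := by
    refine integral_mono (hmul _ (hKi _ (hYK k))).integrableOn
      ((hdi k).integrableOn.add hZi.abs.integrableOn) fun ω => ?_
    calc φ ω * Y k ω ≤ |φ ω| * |Y k ω| := (le_abs_self _).trans (abs_mul _ _).le
      _ ≤ 1 * |Y k ω| := by gcongr; exact hφ ω
      _ = |Y k ω - Z ω + Z ω| := by rw [one_mul, sub_add_cancel]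
      _ ≤ |Y k ω - Z ω| + |Z ω| := abs_add_le _ _
  rw [integral_add (hdi k).integrableOn hZi.abs.integrableOn] at h1
  have h2 : ∫ ω in D k, |Y k ω - Z ω| ∂μ ≤ ∫ ω, |Y k ω - Z ω| ∂μ :=
    setIntegral_le_integral (hdi k) (.of_forall fun ω => abs_nonneg _)
  linarith [hYle k]

end UniformIntegrability

section UniformIntegrabilityCriterion

variable {μ : Measure Ω}

lemma measure_iUnion_add_le_of_le_geometric {A : ℕ → Set Ω} {ρ : ℝ} (hρ : 0 ≤ ρ) {k : ℕ}
    (h : ∀ m, k ≤ m → μ (A m) ≤ ENNReal.ofReal (ρ * (1 / 2) ^ m)) :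
    μ (⋃ m, A (m + k)) ≤ ENNReal.ofReal (2 * ρ * (1 / 2) ^ k) := by
  have hs : HasSum (fun m : ℕ => ρ * (1 / 2 : ℝ) ^ (m + k)) (2 * ρ * (1 / 2) ^ k) := by
    have h1 := hasSum_geometric_two.mul_left (ρ * (1 / 2 : ℝ) ^ k)
    rw [show ρ * (1 / 2 : ℝ) ^ k * 2 = 2 * ρ * (1 / 2) ^ k by ring] at h1
    refine h1.congr_fun fun m => ?_
    rw [pow_add]
    ring
  calc μ (⋃ m, A (m + k)) ≤ ∑' m, μ (A (m + k)) := measure_iUnion_le _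
    _ ≤ ∑' m, ENNReal.ofReal (ρ * (1 / 2) ^ (m + k)) :=
        ENNReal.tsum_le_tsum fun m => h _ (Nat.le_add_left _ _)
    _ = ENNReal.ofReal (2 * ρ * (1 / 2) ^ k) := by
        rw [← ENNReal.ofReal_tsum_of_nonneg (fun m => by positivity) hs.summable, hs.tsum_eq]

lemma setIntegral_iUnion_add_le_of_le_geometric {U : Ω → ℝ} (hU : Integrable U μ) {A : ℕ → Set Ω}
    (hA : ∀ m, MeasurableSet (A m)) {ρ : ℝ} (hρ : 0 ≤ ρ) {k : ℕ}
    (h : ∀ m, k ≤ m → ∫ ω in A m, |U ω| ∂μ ≤ ρ * (1 / 2) ^ m) :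
    ∫ ω in ⋃ m, A (m + k), |U ω| ∂μ ≤ 2 * ρ * (1 / 2) ^ k := by
  have key : ∀ S, MeasurableSet S → (μ.withDensity fun ω => ENNReal.ofReal |U ω|) S =
      ENNReal.ofReal (∫ ω in S, |U ω| ∂μ) := fun S hS => by
    rw [withDensity_apply _ hS, ofReal_integral_eq_lintegral_ofReal hU.abs.integrableOn
      (.of_forall fun ω => abs_nonneg _)]
  have h1 := measure_iUnion_add_le_of_le_geometric (A := A)
    (μ := μ.withDensity fun ω => ENNReal.ofReal |U ω|) hρ (k := k) fun m hm => by
      rw [key _ (hA m)]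
      exact ENNReal.ofReal_le_ofReal (h m hm)
  rwa [key _ (.iUnion fun m => hA _), ENNReal.ofReal_le_ofReal_iff (by positivity)] at h1

lemma exists_seq_small_overlap [IsFiniteMeasure μ] {K : Set (Ω → ℝ)}
    (hKi : ∀ X ∈ K, Integrable X μ) {C : ℝ} (hC : ∀ X ∈ K, ∫ ω, |X ω| ∂μ ≤ C)
    {t ε c : ℝ} (hε : 0 < ε)
    (ht : ∀ b : ℝ, ∃ X ∈ K, t < ∫ ω in {ω | b < |X ω|}, |X ω| ∂μ) :
    ∃ (X : ℕ → Ω → ℝ) (N : ℕ → ℝ), (∀ n, X n ∈ K) ∧ (∀ n, c ≤ N n) ∧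
      (∀ n, t < ∫ ω in {ω | N n < |X n ω|}, |X n ω| ∂μ) ∧
      (∀ n, μ {ω | N n < |X n ω|} ≤ ENNReal.ofReal ((1 / 2) ^ n)) ∧
      ∀ m n, m < n → ∫ ω in {ω | N n < |X n ω|}, |X m ω| ∂μ ≤ ε * (1 / 2) ^ n := by
  have htail : Tendsto (fun p : (Ω → ℝ) × ℝ => μ {ω | p.2 < |p.1 ω|})
      (comap Prod.snd atTop ⊓ 𝓟 {p | p.1 ∈ K}) (nhds 0) := by
    have hlim : Tendsto (fun p : (Ω → ℝ) × ℝ => ENNReal.ofReal (C / p.2))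
        (comap Prod.snd atTop ⊓ 𝓟 {p | p.1 ∈ K}) (nhds 0) := by
      rw [← ENNReal.ofReal_zero]
      exact ENNReal.tendsto_ofReal ((tendsto_const_nhds.div_atTop tendsto_comap).mono_left
        inf_le_left)
    refine tendsto_of_tendsto_of_tendsto_of_le_of_le' tendsto_const_nhds hlim
      (.of_forall fun _ => zero_le) ?_
    rw [eventually_inf_principal]
    filter_upwards [tendsto_comap.eventually (eventually_gt_atTop (0 : ℝ))] with p hp hpK
    rw [← ofReal_measureReal]
    refine ENNReal.ofReal_le_ofReal ?_
    rw [le_div_iff₀' hp]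
    refine (mul_le_mul_of_nonneg_left (measureReal_mono (fun ω hω => ?_)) hp.le).trans
      ((mul_meas_ge_le_integral_of_nonneg (.of_forall fun ω => abs_nonneg (p.1 ω))
        (hKi _ hpK).abs p.2).trans (hC _ hpK))
    simp only [mem_ofPred_eq] at hω ⊢
    exact hω.le
  have hmeas : ∀ i : ℕ, ∀ᶠ b in atTop, ∀ X ∈ K,
      μ {ω | b < |X ω|} ≤ ENNReal.ofReal ((1 / 2) ^ i) := by
    intro i
    have h1 := htail.eventually_le_const (show (0 : ENNReal) < ENNReal.ofReal ((1 / 2) ^ i) by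
      rw [ENNReal.ofReal_pos]; positivity)
    rw [eventually_inf_principal, eventually_comap] at h1
    filter_upwards [h1] with b hb X hX using hb (X, b) rfl hX
  have hinteg : ∀ U ∈ K, ∀ i : ℕ, ∀ᶠ b in atTop, ∀ X ∈ K,
      ∫ ω in {ω | b < |X ω|}, |U ω| ∂μ ≤ ε * (1 / 2) ^ i := by
    intro U hU i
    have h1 := ((hKi U hU).abs.tendsto_setIntegral_nhds_zero htail).eventually_le_const
      (show (0 : ℝ) < ε * (1 / 2) ^ i by positivity)
    rw [eventually_inf_principal, eventually_comap] at h1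
    filter_upwards [h1] with b hb X hX using hb (X, b) rfl hX
  obtain ⟨f, hf, hr⟩ := exists_seq_of_forall_finset_exists
    (fun x : ℕ × ℝ × (Ω → ℝ) => x.2.2 ∈ K ∧ c ≤ x.2.1 ∧
      t < ∫ ω in {ω | x.2.1 < |x.2.2 ω|}, |x.2.2 ω| ∂μ ∧
      μ {ω | x.2.1 < |x.2.2 ω|} ≤ ENNReal.ofReal ((1 / 2) ^ x.1))
    (fun x y => x.1 < y.1 ∧ ∫ ω in {ω | y.2.1 < |y.2.2 ω|}, |x.2.2 ω| ∂μ ≤ ε * (1 / 2) ^ y.1)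
    (fun s hs => by
      set i := s.sup Prod.fst + 1
      have h1 : ∀ᶠ b in atTop, ∀ x ∈ s, ∀ X ∈ K,
          ∫ ω in {ω | b < |X ω|}, |x.2.2 ω| ∂μ ≤ ε * (1 / 2) ^ i :=
        (eventually_all_finset s).2 fun x hx => hinteg _ (hs x hx).1 i
      obtain ⟨b, hb1, hb2, hb3⟩ := (h1.and ((hmeas i).and (eventually_ge_atTop c))).exists
      obtain ⟨X, hX, hXt⟩ := ht b
      exact ⟨(i, b, X), ⟨hX, hb3, hXt, hb2 X hX⟩, fun x hx =>
        ⟨Nat.lt_succ_of_le (Finset.le_sup (f := Prod.fst) hx), hb1 x hx X hX⟩⟩)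
  have hidx : ∀ n, n ≤ (f n).1 := fun n =>
    (strictMono_nat_of_lt_succ fun n => (hr n _ n.lt_succ_self).1).le_apply
  have hpow : ∀ n, (1 / 2 : ℝ) ^ (f n).1 ≤ (1 / 2) ^ n := fun n =>
    pow_le_pow_of_le_one (by norm_num) (by norm_num) (hidx n)
  refine ⟨fun n => (f n).2.2, fun n => (f n).2.1, fun n => (hf n).1, fun n => (hf n).2.1,
    fun n => (hf n).2.2.1, fun n => (hf n).2.2.2.trans (ENNReal.ofReal_le_ofReal (hpow n)),
    fun m n hmn => (hr m n hmn).2.trans (mul_le_mul_of_nonneg_left (hpow n) hε.le)⟩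

lemma uiset_of_tendsto_L1_of_measurable [IsProbabilityMeasure μ] {K : Set (Ω → ℝ)}
    (hK : Convex ℝ K) (hKm : ∀ X ∈ K, Measurable X) (hKb : BddL1 μ K)
    (h : ∀ (Xs : ℕ → Ω → ℝ) (X : Ω → ℝ), (∀ n, Xs n ∈ K) → TendstoInMeasure μ Xs atTop X →
      Tendsto (fun n => ∫⁻ ω, ENNReal.ofReal |Xs n ω - X ω| ∂μ) atTop (nhds 0)) :
    UIset μ K := by
  obtain ⟨hKi, C, hC⟩ := hKb
  refine ⟨hKi, ?_⟩
  by_contra! hcon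
  obtain ⟨ε₀, hε₀, hbig⟩ := hcon
  set S : Set ℝ := {t | ∀ b : ℝ, ∃ X ∈ K, t < ∫ ω in {ω | b < |X ω|}, |X ω| ∂μ} with hS
  have hmem : ε₀ / 2 ∈ S := fun b => by
    obtain ⟨X, hX, hb⟩ := hbig b
    exact ⟨X, hX, by linarith⟩
  have hSbdd : BddAbove S := ⟨C, fun t ht => by
    obtain ⟨X, hX, hb⟩ := ht 0
    exact hb.le.trans ((setIntegral_le_integral (hKi X hX).abs
      (.of_forall fun ω => abs_nonneg _)).trans (hC X hX))⟩
  set α := sSup S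
  have hα : 0 < α := (half_pos hε₀).trans_le (le_csSup hSbdd hmem)
  obtain ⟨t, htS, hαt⟩ := exists_lt_of_lt_csSup ⟨_, hmem⟩ (show α - α / 16 < α by linarith)
  have hnot : α + α / 16 ∉ S := fun hmem' => by
    have : α + α / 16 ≤ α := le_csSup hSbdd hmem'
    linarith
  simp only [hS, mem_ofPred_eq, not_forall, not_exists, not_and, not_lt] at hnot
  obtain ⟨c', hc'⟩ := hnot
  set c := max c' 0
  have hc : ∀ X ∈ K, ∫ ω in {ω | c < |X ω|}, |X ω| ∂μ ≤ α + α / 16 := fun X hX =>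
    (setIntegral_mono_set (hKi X hX).abs.integrableOn (.of_forall fun ω => abs_nonneg _)
      (LE.le.eventuallyLE fun ω hω => (le_max_left c' 0).trans_lt hω)).trans (hc' X hX)
  obtain ⟨X, N, hXK, hcN, hXt, hXμ, hover⟩ := exists_seq_small_overlap hKi hC (c := c)
    (show 0 < α / 16 by linarith) htS
  set A : ℕ → Set Ω := fun n => {ω | N n < |X n ω|} with hA
  have hAm : ∀ n, MeasurableSet (A n) := fun n =>
    measurableSet_lt measurable_const (hKm _ (hXK n)).abs
  set D : ℕ → Set Ω := fun k => ⋃ m, A (m + k) with hD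
  have hDanti : Antitone D := fun k l hkl => iUnion_subset fun m => by
    refine subset_iUnion_of_subset (m + (l - k)) ?_
    rw [add_assoc, Nat.sub_add_cancel hkl]
  have hDm : ∀ k, MeasurableSet (D k) := fun k => .iUnion fun m => hAm _
  have hAD : ∀ n, A n ⊆ D n := fun n => subset_iUnion_of_subset 0 (by rw [zero_add])
  have hDμ : Tendsto (fun k => μ (D k)) atTop (nhds 0) := by
    refine tendsto_of_tendsto_of_tendsto_of_le_of_le tendsto_const_nhds ?_ (fun _ => zero_le)
      fun k => measure_iUnion_add_le_of_le_geometric zero_le_one (k := k) fun m _ => by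
        rw [one_mul]; exact hXμ m
    rw [← ENNReal.ofReal_zero]
    refine ENNReal.tendsto_ofReal ?_
    simpa using (tendsto_pow_atTop_nhds_zero_of_lt_one (r := (1 / 2 : ℝ)) (by norm_num)
      (by norm_num)).const_mul 2
  obtain ⟨φ, hφm, hφ1, hφ⟩ := exists_sign_test (fun n => hKm _ (hXK n)) (fun n => hKi _ (hXK n))
    (le_max_right c' 0) hcN hDm hDanti hAD
  have hDint : ∀ n, ∫ ω in D (n + 1), |X n ω| ∂μ ≤ α / 16 := by
    intro n
    refine (setIntegral_iUnion_add_le_of_le_geometric (hKi _ (hXK n)) hAm (k := n + 1)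
      (show 0 ≤ α / 16 by linarith) fun m hm => hover n m hm).trans ?_
    have : (1 / 2 : ℝ) ^ n ≤ 1 := pow_le_one₀ (by norm_num) (by norm_num)
    rw [pow_succ]
    nlinarith
  have := nonpos_of_le_setIntegral_mul hK hKi hC h hXK hφm hφ1 hDμ (a := α / 2) (c := c)
    fun k n hkn => by
      have h1 := hφ k n hkn
      have h2 := hXt n
      have h3 := hc _ (hXK n)
      have h4 := hDint n
      linarith
  linarith

lemma uiset_of_tendsto_L1 [IsProbabilityMeasure μ] {K : Set (Ω → ℝ)}
    (hK : Convex ℝ K) (hKb : BddL1 μ K)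
    (h : ∀ (Xs : ℕ → Ω → ℝ) (X : Ω → ℝ), (∀ n, Xs n ∈ K) → TendstoInMeasure μ Xs atTop X →
      Tendsto (fun n => ∫⁻ ω, ENNReal.ofReal |Xs n ω - X ω| ∂μ) atTop (nhds 0)) :
    UIset μ K := by
  set K' : Set (Ω → ℝ) := {X | Measurable X ∧ ∃ Y ∈ K, X =ᵐ[μ] Y} with hK'
  have habs : ∀ {X Y : Ω → ℝ}, X =ᵐ[μ] Y → (fun ω => |X ω|) =ᵐ[μ] fun ω => |Y ω| := fun hXY =>
    hXY.mono fun ω hω => by simp only [hω]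
  have hconv : Convex ℝ K' := by
    rintro X ⟨hX, X', hX', hXX⟩ Y ⟨hY, Y', hY', hYY⟩ a b ha hb hab
    refine ⟨(hX.const_smul a).add (hY.const_smul b), _, hK hX' hY' ha hb hab, ?_⟩
    exact (hXX.const_smul a).add (hYY.const_smul b)
  have hb' : BddL1 μ K' := by
    obtain ⟨hi, C, hC⟩ := hKb
    refine ⟨?_, C, ?_⟩
    · rintro X ⟨-, Y, hY, hXY⟩
      exact (hi Y hY).congr hXY.symm
    · rintro X ⟨-, Y, hY, hXY⟩
      rw [integral_congr_ae (habs hXY)]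
      exact hC Y hY
  obtain ⟨-, hUI⟩ := uiset_of_tendsto_L1_of_measurable hconv (fun X hX => hX.1) hb' (by
    intro Xs X hXs hlim
    choose hm Y hY hXY using hXs
    refine (h Y X hY (hlim.congr_left hXY)).congr fun n => ?_
    exact lintegral_congr_ae ((hXY n).mono fun ω hω => by simp only [hω]))
  refine ⟨hKb.1, fun ε hε => ?_⟩
  obtain ⟨c, hc⟩ := hUI ε hε
  refine ⟨c, fun X hX => ?_⟩
  have hXa := (hKb.1 X hX).aestronglyMeasurable.aemeasurable
  have h1 := hc (hXa.mk X) ⟨hXa.measurable_mk, X, hX, hXa.ae_eq_mk.symm⟩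
  have hset : {ω | c < |X ω|} =ᵐ[μ] {ω | c < |hXa.mk X ω|} :=
    eventuallyEq_set.2 (hXa.ae_eq_mk.mono fun ω hω => by simp only [mem_ofPred_eq, hω])
  rwa [setIntegral_congr_set hset, integral_congr_ae (ae_restrict_of_ae (habs hXa.ae_eq_mk))]

end UniformIntegrabilityCriterion

section UniformLocalConvexSolidity

variable {P Q : Measure Ω}

lemma eLpNorm_one_sub_eq_lintegral_ofReal_abs (X Y : Ω → ℝ) :
    eLpNorm (X - Y) 1 Q = ∫⁻ ω, ENNReal.ofReal |X ω - Y ω| ∂Q := by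
  simp only [eLpNorm_one_eq_lintegral_enorm, Pi.sub_apply, Real.enorm_eq_ofReal_abs]

/-- Vitali's convergence theorem for a uniformly integrable set of random variables. -/
lemma UIset.tendsto_L1 [IsFiniteMeasure Q] {K : Set (Ω → ℝ)} (hK : UIset Q K)
    {Xs : ℕ → Ω → ℝ} {X : Ω → ℝ} (hXs : ∀ n, Xs n ∈ K) (h : TendstoInMeasure Q Xs atTop X) :
    Tendsto (fun n => ∫⁻ ω, ENNReal.ofReal |Xs n ω - X ω| ∂Q) atTop (nhds 0) := by
  obtain ⟨hi, hUI⟩ := hK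
  have hm : ∀ n, AEStronglyMeasurable (Xs n) Q := fun n => (hi _ (hXs n)).aestronglyMeasurable
  have hunif : UniformIntegrable Xs 1 Q := by
    refine uniformIntegrable_of le_rfl ENNReal.one_ne_top hm fun ε hε => ?_
    obtain ⟨c, hc⟩ := hUI ε hε
    refine ⟨(max c 0 + 1).toNNReal, fun n => ?_⟩
    have hsub : {ω | (max c 0 + 1).toNNReal ≤ ‖Xs n ω‖₊} ⊆ {ω | c < |Xs n ω|} := by
      intro ω hω
      simp only [mem_ofPred_eq, Real.toNNReal_le_iff_le_coe, coe_nnnorm, Real.norm_eq_abs] at hω ⊢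
      linarith [le_max_left c 0]
    rw [eLpNorm_one_eq_lintegral_enorm]
    simp only [enorm_indicator_eq_indicator_enorm]
    calc _ ≤ ∫⁻ ω in {ω | (max c 0 + 1).toNNReal ≤ ‖Xs n ω‖₊}, ‖Xs n ω‖ₑ ∂Q :=
          lintegral_indicator_le _ _
      _ ≤ ∫⁻ ω in {ω | c < |Xs n ω|}, ‖Xs n ω‖ₑ ∂Q := lintegral_mono_set hsub
      _ = ENNReal.ofReal (∫ ω in {ω | c < |Xs n ω|}, |Xs n ω| ∂Q) := by
          rw [ofReal_integral_eq_lintegral_ofReal (hi _ (hXs n)).abs.integrableOn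
            (.of_forall fun ω => abs_nonneg _)]
          simp only [Real.enorm_eq_ofReal_abs]
      _ ≤ ENNReal.ofReal ε := ENNReal.ofReal_le_ofReal (hc _ (hXs n)).le
  have := tendsto_Lp_finite_of_tendstoInMeasure le_rfl ENNReal.one_ne_top hm
    (hunif.memLp_of_tendstoInMeasure h) hunif.unifIntegrable h
  simpa only [eLpNorm_one_sub_eq_lintegral_ofReal_abs] using this

lemma exists_forall_lintegral_le_probDist_lt [IsProbabilityMeasure P] [IsFiniteMeasure Q]
    (hQP : Q ≪ P) (hPQ : P ≪ Q) {ε : ℝ} (hε : 0 < ε) :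
    ∃ η : ℝ, 0 < η ∧ ∀ Z : Ω → ℝ, AEStronglyMeasurable Z P →
      ∫⁻ ω, ENNReal.ofReal |Z ω| ∂Q ≤ ENNReal.ofReal η → probDist P Z 0 < ε := by
  by_contra! hcon
  choose Z hZm hZ hZε using fun n : ℕ => hcon (1 / ((n : ℝ) + 1)) (by positivity)
  have hlim : Tendsto (fun n => ∫⁻ ω, ENNReal.ofReal |Z n ω| ∂Q) atTop (nhds 0) := by
    refine tendsto_of_tendsto_of_tendsto_of_le_of_le tendsto_const_nhds ?_ (fun _ => zero_le) hZ
    rw [← ENNReal.ofReal_zero]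
    exact ENNReal.tendsto_ofReal tendsto_one_div_add_atTop_nhds_zero_nat
  have hQm := fun n => (hZm n).mono_ac hQP
  have h1 : TendstoInMeasure Q Z atTop 0 := by
    refine tendstoInMeasure_of_tendsto_eLpNorm one_ne_zero hQm aestronglyMeasurable_zero ?_
    simpa only [sub_zero, eLpNorm_one_eq_lintegral_enorm, Real.enorm_eq_ofReal_abs] using hlim
  have h2 := tendsto_probDist hZm (tendstoInMeasure_of_absolutelyContinuous hPQ hQm h1)
  exact hε.not_ge (ge_of_tendsto' h2 hZε)

lemma exists_forall_probDist_lt_lintegral_le [IsProbabilityMeasure P] [IsFiniteMeasure Q]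
    (hQP : Q ≪ P) {K : Set (Ω → ℝ)} (hKm : ∀ X ∈ K, AEStronglyMeasurable X P) (hK : UIset Q K)
    {X : Ω → ℝ} (hX : X ∈ probClosure P K) {η : ℝ} (hη : 0 < η) :
    ∃ δ : ℝ, 0 < δ ∧ ∀ Z ∈ probClosure P K, probDist P Z X < δ →
      ∫⁻ ω, ENNReal.ofReal |Z ω - X ω| ∂Q ≤ ENNReal.ofReal η := by
  have hm := fun {U} (hU : U ∈ probClosure P K) => aestronglyMeasurable_of_mem_probClosure hKm hU
  have hL1 : ∀ {Xs : ℕ → Ω → ℝ} {U : Ω → ℝ}, (∀ n, Xs n ∈ K) → TendstoInMeasure P Xs atTop U →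
      Tendsto (fun n => ∫⁻ ω, ENNReal.ofReal |Xs n ω - U ω| ∂Q) atTop (nhds 0) :=
    fun hXs h => hK.tendsto_L1 hXs
      (tendstoInMeasure_of_absolutelyContinuous hQP (fun n => hKm _ (hXs n)) h)
  by_contra! hcon
  choose Z hZK hZX hZη using fun n : ℕ => hcon (1 / ((n : ℝ) + 1)) (by positivity)
  have hη2 : 0 < ENNReal.ofReal (η / 2) := ENNReal.ofReal_pos.2 (half_pos hη)
  have happrox : ∀ n, ∃ U ∈ K, probDist P U (Z n) < 1 / ((n : ℝ) + 1) ∧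
      ∫⁻ ω, ENNReal.ofReal |U ω - Z n ω| ∂Q < ENNReal.ofReal (η / 2) := by
    intro n
    obtain ⟨Us, hUs, hlim⟩ := hZK n
    obtain ⟨m, h1, h2⟩ := (((tendsto_probDist (fun n => hKm _ (hUs n)) hlim).eventually_lt_const
      (show (0 : ℝ) < 1 / ((n : ℝ) + 1) by positivity)).and
      ((hL1 hUs hlim).eventually_lt_const hη2)).exists
    exact ⟨Us m, hUs m, h1, h2⟩
  choose U hUK hUZ hUη using happrox
  have hdist : Tendsto (fun n => probDist P (U n) X) atTop (nhds 0) := by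
    have hlim := (tendsto_one_div_add_atTop_nhds_zero_nat (𝕜 := ℝ)).add
      (tendsto_one_div_add_atTop_nhds_zero_nat (𝕜 := ℝ))
    rw [add_zero] at hlim
    refine squeeze_zero (fun n => integral_nonneg fun ω => by positivity) (fun n => ?_) hlim
    refine le_trans ?_ (add_le_add (hUZ n).le (hZX n).le)
    have i1 := integrable_min_abs_sub_one (hKm _ (hUK n)) (hm (hZK n))
    have i2 := integrable_min_abs_sub_one (hm (hZK n)) (hm hX)
    rw [probDist, probDist, probDist, ← integral_add i1 i2]
    refine integral_mono (integrable_min_abs_sub_one (hKm _ (hUK n)) (hm hX)) (i1.add i2)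
      fun ω => ?_
    have h1 := abs_sub_le (U n ω) (Z n ω) (X ω)
    have h2 := abs_nonneg (U n ω - Z n ω)
    have h3 := abs_nonneg (Z n ω - X ω)
    rcases min_cases |U n ω - X ω| 1 with h | h <;>
      rcases min_cases |U n ω - Z n ω| 1 with h' | h' <;>
      rcases min_cases |Z n ω - X ω| 1 with h'' | h'' <;> linarith
  have hUX := hL1 hUK (tendstoInMeasure_of_tendsto_probDist (fun n => hKm _ (hUK n)) (hm hX) hdist)
  obtain ⟨n, hn⟩ := (hUX.eventually_lt_const hη2).exists
  refine (hZη n).not_ge ?_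
  have hUQ := (hKm _ (hUK n)).mono_ac hQP
  calc ∫⁻ ω, ENNReal.ofReal |Z n ω - X ω| ∂Q
      = ∫⁻ ω, ENNReal.ofReal |(U n ω - X ω) - (U n ω - Z n ω)| ∂Q := by
        simp only [sub_sub_sub_cancel_left]
    _ ≤ ∫⁻ ω, ENNReal.ofReal |U n ω - X ω| ∂Q + ∫⁻ ω, ENNReal.ofReal |U n ω - Z n ω| ∂Q :=
        lintegral_abs_sub_le (X := fun ω => U n ω - X ω) (hUQ.sub ((hm hX).mono_ac hQP))
    _ ≤ ENNReal.ofReal (η / 2) + ENNReal.ofReal (η / 2) := add_le_add hn.le (hUη n).le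
    _ = ENNReal.ofReal η := by
        rw [← ENNReal.ofReal_add (half_pos hη).le (half_pos hη).le, add_halves]

lemma unifLCS_of_uiset [IsProbabilityMeasure P] {K : Set (Ω → ℝ)} (hKb : BddL1 P K)
    (hPQ : EquivProb P Q) (hK : UIset Q K) : UnifLCS P (probClosure P K) (probClosure P K) := by
  obtain ⟨hQ, hQP, hPQ⟩ := hPQ
  have hKm : ∀ X ∈ K, AEStronglyMeasurable X P := fun X hX => (hKb.1 X hX).aestronglyMeasurable
  obtain ⟨C, hCtop, hC⟩ := hKb.exists_lintegral_le
  have hinteg : ∀ X ∈ probClosure P K, Integrable X P := fun X hX => by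
    refine ⟨aestronglyMeasurable_of_mem_probClosure hKm hX, ?_⟩
    simpa only [HasFiniteIntegral, Real.enorm_eq_ofReal_abs] using
      (lintegral_abs_le_of_mem_probClosure hKm hC hX).trans_lt hCtop.lt_top
  intro ε hε
  obtain ⟨η, hη, hsmall⟩ := exists_forall_lintegral_le_probDist_lt hQP hPQ hε
  refine ⟨{Z | Integrable Z P ∧ ∫⁻ ω, ENNReal.ofReal |Z ω| ∂Q ≤ ENNReal.ofReal η},
    fun Z hZ => hZ.1, ?_, ?_, fun Z hZ => hsmall Z hZ.1.aestronglyMeasurable hZ.2, fun X hX => ?_⟩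
  · rintro U ⟨hU, hU'⟩ V ⟨hV, hV'⟩ a b ha hb hab
    refine ⟨(hU.smul a).add (hV.smul b), ?_⟩
    have hUQ := (hU.aestronglyMeasurable.mono_ac hQP).aemeasurable.abs.ennreal_ofReal
    have hVQ := (hV.aestronglyMeasurable.mono_ac hQP).aemeasurable.abs.ennreal_ofReal
    calc ∫⁻ ω, ENNReal.ofReal |(a • U + b • V) ω| ∂Q
        ≤ ∫⁻ ω, (ENNReal.ofReal a * ENNReal.ofReal |U ω| +
            ENNReal.ofReal b * ENNReal.ofReal |V ω|) ∂Q := by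
          refine lintegral_mono fun ω => ?_
          rw [← ENNReal.ofReal_mul ha, ← ENNReal.ofReal_mul hb,
            ← ENNReal.ofReal_add (by positivity) (by positivity)]
          refine ENNReal.ofReal_le_ofReal ((abs_add_le _ _).trans_eq ?_)
          simp [abs_mul, abs_of_nonneg ha, abs_of_nonneg hb]
      _ = ENNReal.ofReal a * ∫⁻ ω, ENNReal.ofReal |U ω| ∂Q +
            ENNReal.ofReal b * ∫⁻ ω, ENNReal.ofReal |V ω| ∂Q := by
          rw [lintegral_add_left' (hUQ.const_mul _), lintegral_const_mul'' _ hUQ,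
            lintegral_const_mul'' _ hVQ]
      _ ≤ ENNReal.ofReal a * ENNReal.ofReal η + ENNReal.ofReal b * ENNReal.ofReal η := by gcongr
      _ = ENNReal.ofReal η := by
          rw [← add_mul, ← ENNReal.ofReal_add ha hb, hab, ENNReal.ofReal_one, one_mul]
  · rintro U ⟨hU, hU'⟩ V hV hVU
    refine ⟨hU.mono hV hVU, (lintegral_mono_ae ?_).trans hU'⟩
    have hVUQ : ∀ᵐ ω ∂Q, |V ω| ≤ |U ω| := hQP.ae_le hVU
    exact hVUQ.mono fun ω hω => ENNReal.ofReal_le_ofReal hω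
  · obtain ⟨δ, hδ, h⟩ := exists_forall_probDist_lt_lintegral_le hQP hKm hK hX hη
    exact ⟨δ, hδ, fun Z hZ hZX => ⟨(hinteg Z hZ).sub (hinteg X hX), h Z hZ hZX⟩⟩

lemma exists_equivProb_uiset [IsProbabilityMeasure P] {K : Set (Ω → ℝ)} (hKc : Convex ℝ K)
    (hKb : BddL1 P K) (h : UnifLCS P (probClosure P K) (probClosure P K)) :
    ∃ Q : Measure Ω, EquivProb P Q ∧ UIset Q K := by
  rcases K.eq_empty_or_nonempty with rfl | hne
  · exact ⟨P, ⟨inferInstance, .rfl, .rfl⟩, by simp [UIset]⟩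
  obtain ⟨Q, hPQ, ⟨C, hCtop, hC⟩, hlim⟩ := exists_equivProb_tendsto_L1 hne hKb h
  have := hPQ.1
  have hKm : ∀ X ∈ K, AEStronglyMeasurable X Q := fun X hX =>
    (hKb.1 X hX).aestronglyMeasurable.mono_ac hPQ.2.1
  refine ⟨Q, hPQ, uiset_of_tendsto_L1 hKc ⟨fun X hX => ⟨hKm X hX, ?_⟩, C.toReal, fun X hX => ?_⟩
    fun Xs X hXs hX => hlim Xs X hXs
      (tendstoInMeasure_of_absolutelyContinuous hPQ.2.2 (fun n => hKm _ (hXs n)) hX)⟩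
  · simpa only [HasFiniteIntegral, Real.enorm_eq_ofReal_abs] using (hC X hX).trans_lt hCtop.lt_top
  · rw [integral_eq_lintegral_of_nonneg_ae (.of_forall fun ω => abs_nonneg _)
      (hKm X hX).norm]
    exact ENNReal.toReal_mono hCtop (hC X hX)

end UniformLocalConvexSolidity

/-- Corollary 3.4: a measure-free characterization of uniform integrability with respect to
some equivalent probability measure. -/
theorem statement6 (P : Measure Ω) [IsProbabilityMeasure P]
    (K : Set (Ω → ℝ)) (hKconv : Convex ℝ K) (hKbdd : BddL1 P K) :
    UnifLCS P (probClosure P K) (probClosure P K) ↔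
      (∃ Q : Measure Ω, EquivProb P Q ∧ UIset Q K) := by
  exact ⟨exists_equivProb_uiset hKconv hKbdd, fun ⟨_, hPQ, hK⟩ => unifLCS_of_uiset hKbdd hPQ hK⟩

end Paper
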